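/- arXiv:1709.02071 — 5 statements merged into one kernel-verified Lean document; each statement's English description precedes it below -/
import Mathlib

section
/- For all integers x, y, z ≥ 1 and a, b ≥ 1, one has ψ_{x,y-1,z}(a,b) · ψ_{x,y,z-1}(a,b) / ( ψ_{x,y-1,z-1}(a,b) · ψ_{x,y,z}(a,b) ) = (y+z+a+b)(2x+y+z+2a+2b) / ( (x+y+z+a+b)(x+y+z+2a+2b) ). -/
open Finset Nat

/-- Pochhammer symbol `(q)_n` for real `q` and integer `n`. -/
noncomputable def poch (q : ℝ) (n : ℤ) : ℝ :=
  if 0 ≤ n then ∏ i ∈ Finset.range n.toNat, (q + i)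
  else 1 / ∏ i ∈ Finset.range (-n).toNat, (q - (i + 1))

/-- Skipping Pochhammer symbol `[q]_n`. -/
noncomputable def spoch (q : ℝ) (n : ℤ) : ℝ :=
  if 0 ≤ n then ∏ i ∈ Finset.range n.toNat, (q + 2 * i)
  else 1 / ∏ i ∈ Finset.range (-n).toNat, (q - 2 * (i + 1))

/-- Trapezoidal product `T(q,n,m) = ∏_{i=0}^{m-1} (q+i)_{n-2i}`. -/
noncomputable def trapT (q : ℝ) (n m : ℤ) : ℝ :=
  ∏ i ∈ Finset.range m.toNat, poch (q + i) (n - 2 * i)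

/-- Skipping trapezoidal product `V(q,n,m) = ∏_{i=0}^{m-1} [q+2i]_{n-2i}`. -/
noncomputable def trapV (q : ℝ) (n m : ℤ) : ℝ :=
  ∏ i ∈ Finset.range m.toNat, spoch (q + 2 * i) (n - 2 * i)

/-- Hyperfactorial `H(n) = 0!·1!·2!⋯(n-1)!`. -/
def hyperfac (n : ℕ) : ℕ := ∏ i ∈ Finset.range n, i !

/-- Skipping hyperfactorial `H₂(n)`:
`0!·2!·4!⋯(n-2)!` if `n` is even, `1!·3!·5!⋯(n-2)!` if `n` is odd. -/
def hyperfac2 (n : ℕ) : ℕ :=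
  ∏ i ∈ Finset.range (n / 2), (if n % 2 = 0 then (2 * i)! else (2 * i + 1)!)

/-- Partial sum `s_k(t) = t 1 + ⋯ + t k` (sequences are indexed from 1). -/
def pSum (t : ℕ → ℕ) (k : ℕ) : ℕ := ∑ i ∈ Finset.Icc 1 k, t i

/-- `E(t) = t 2 + t 4 + ⋯ + t (2l)` for a sequence of length `2l`. -/
def evenSum (l : ℕ) (t : ℕ → ℕ) : ℕ := ∑ i ∈ Finset.Icc 1 l, t (2 * i)

/-- `Q(t₁,…,t_{2l})`. -/
noncomputable def Qfun (l : ℕ) (t : ℕ → ℕ) : ℝ :=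
  ((∏ i ∈ Finset.Icc 1 l, ((pSum t (2 * i))! : ℝ) / ((pSum t (2 * i - 1))! : ℝ)) /
      (hyperfac2 (2 * evenSum l t + 1) : ℝ)) *
    (∏ i ∈ Finset.Icc 1 l,
      ((hyperfac2 (2 * pSum t (2 * i) + 1) : ℝ) * (hyperfac (2 * pSum t (2 * i - 1) + 2) : ℝ)) /
        (hyperfac2 (2 * pSum t (2 * i - 1) + 3) : ℝ)) *
    (∏ p ∈ (Finset.Icc 1 (2 * l) ×ˢ Finset.Icc 1 (2 * l)).filter
        (fun p => p.1 < p.2 ∧ (p.2 - p.1) % 2 = 1),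
      (hyperfac (pSum t p.2 - pSum t p.1) : ℝ) / (hyperfac (pSum t p.2 + pSum t p.1 + 1) : ℝ)) *
    (∏ p ∈ (Finset.Icc 1 (2 * l) ×ˢ Finset.Icc 1 (2 * l)).filter
        (fun p => p.1 < p.2 ∧ (p.2 - p.1) % 2 = 0),
      (hyperfac (pSum t p.2 + pSum t p.1 + 1) : ℝ) / (hyperfac (pSum t p.2 - pSum t p.1) : ℝ))

/-- Build an indexed-from-1 sequence from a list. -/
def seqOf (L : List ℕ) : ℕ → ℕ := fun i => L.getD (i - 1) 0

/-- `Q` on four entries. -/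
noncomputable def Q4 (t1 t2 t3 t4 : ℕ) : ℝ := Qfun 2 (seqOf [t1, t2, t3, t4])

/-- Proctor's product formula `P_{a,b,c}`. -/
noncomputable def Pf (a b c : ℕ) : ℝ :=
  ∏ i ∈ Finset.Icc 1 a,
    ((∏ j ∈ Finset.Icc 1 (b - a + 1), ((c + i + j - 1 : ℕ) : ℝ) / ((i + j - 1 : ℕ) : ℝ)) *
      ∏ j ∈ Finset.Icc (b - a + 2) (b - a + i),
        ((2 * c + i + j - 1 : ℕ) : ℝ) / ((i + j - 1 : ℕ) : ℝ))

/-- Ciucu's product formula `P′_{a,b,c}`. -/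
noncomputable def Pf' (a b c : ℕ) : ℝ :=
  (2 : ℝ) ^ (-(a : ℤ)) *
    (∏ i ∈ Finset.Icc 1 a, ((2 * c + (b - a) + i : ℕ) : ℝ) / ((c + (b - a) + i : ℕ) : ℝ)) *
    Pf a b c

/-- `φ_{x,y,z}(a,b)`. -/
noncomputable def phi (x y z a b : ℕ) : ℝ :=
  (Pf y (y + 2 * a) b * Pf (z + b) (z + b) a * Q4 a b x (y + z) /
      Pf (y + z + b) (y + z + b) a) *
    (trapT ((x : ℝ) + b + 1) ((y : ℤ) + a - 1) a *
      trapT ((x : ℝ) + z + a + b + 2) ((y : ℤ) + a - 1) a *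
      trapT (2 * (a : ℝ) + b + 2) ((y : ℤ) + b - 1) b *
      trapT ((z : ℝ) + 1) ((y : ℤ) + b - 1) b) /
    (trapT ((b : ℝ) + 1) ((y : ℤ) + a - 1) a *
      trapT ((z : ℝ) + a + b + 2) ((y : ℤ) + a - 1) a *
      trapT ((x : ℝ) + 2 * a + b + 2) ((y : ℤ) + b - 1) b *
      trapT ((x : ℝ) + z + 1) ((y : ℤ) + b - 1) b)

/-- `ψ_{x,y,z}(a,b)`. -/
noncomputable def psi (x y z a b : ℕ) : ℝ :=
  (Pf' y (y + 2 * a + 1) b * Pf (z + b) (z + b) a * Q4 a b x (y + z) /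
      Pf (y + z + b) (y + z + b) a) *
    (trapV (2 * (a : ℝ) + 2 * b + 3) ((y : ℤ) + z - 1) y /
      trapV (2 * (x : ℝ) + 2 * a + 2 * b + 3) ((y : ℤ) + z - 1) y) *
    (trapT ((x : ℝ) + b + 1) ((y : ℤ) + z + 2 * a) y *
      trapT (2 * (a : ℝ) + b + 2) ((y : ℤ) + b - 1) b *
      trapT ((z : ℝ) + 1) ((y : ℤ) + b - 1) b) /
    (trapT ((b : ℝ) + 1) ((y : ℤ) + z + 2 * a) y *
      trapT ((x : ℝ) + 2 * a + b + 2) ((y : ℤ) + b - 1) b *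
      trapT ((x : ℝ) + z + 1) ((y : ℤ) + b - 1) b)


/-- Kuo-type ratio of a two-parameter function; it is multiplicative. -/
noncomputable def KR (f : ℕ → ℕ → ℝ) (y z : ℕ) : ℝ :=
  f y (z + 1) * f (y + 1) z / (f y z * f (y + 1) (z + 1))

lemma KR_mul (f g : ℕ → ℕ → ℝ) (y z : ℕ) :
    KR (fun y z => f y z * g y z) y z = KR f y z * KR g y z := by
  simp only [KR, div_eq_mul_inv, mul_inv]; ring

lemma KR_div (f g : ℕ → ℕ → ℝ) (y z : ℕ) :
    KR (fun y z => f y z / g y z) y z = KR f y z / KR g y z := by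
  simp only [KR, div_eq_mul_inv, mul_inv, inv_inv]; ring

lemma KR_fst (f : ℕ → ℝ) (hf : ∀ n, f n ≠ 0) (y z : ℕ) : KR (fun y _ => f y) y z = 1 := by
  have := hf y; have := hf (y + 1)
  simp only [KR]; field_simp

lemma KR_snd (f : ℕ → ℝ) (hf : ∀ n, f n ≠ 0) (y z : ℕ) : KR (fun _ z => f z) y z = 1 := by
  have := hf z; have := hf (z + 1)
  simp only [KR]; field_simp

lemma KR_step (g : ℕ → ℝ) (r : ℕ → ℝ) (hg : ∀ n, g n ≠ 0) (hr : ∀ n, r n ≠ 0)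
    (h : ∀ n, g (n + 1) = g n * r n) (y z : ℕ) :
    KR (fun y z => g (y + z)) y z = r (y + z) / r (y + z + 1) := by
  simp only [KR]
  rw [show y + 1 + (z + 1) = y + z + 1 + 1 by ring, show y + (z + 1) = y + z + 1 by ring,
    show y + 1 + z = y + z + 1 by ring, h (y + z + 1), h (y + z)]
  have := hg (y + z); have := hr (y + z); have := hr (y + z + 1)
  field_simp

lemma poch_succ (q : ℝ) (n : ℤ) (h : q + n ≠ 0) : poch q (n + 1) = poch q n * (q + n) := by
  unfold poch
  rcases lt_trichotomy n (-1) with hn | hn | hn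
  · rw [if_neg (by omega), if_neg (by omega)]
    obtain ⟨k, rfl⟩ : ∃ k : ℕ, n = -(k + 1 : ℤ) := ⟨(-n - 1).toNat, by omega⟩
    rw [show (-(-(k + 1 : ℤ) + 1)).toNat = k by omega,
      show (-(-(k + 1 : ℤ))).toNat = k + 1 by omega, Finset.prod_range_succ]
    push_cast at h ⊢
    have e : q + (-(k + 1 : ℝ)) = q - (k + 1) := by ring
    rw [e] at h ⊢
    rw [one_div, one_div, mul_inv, mul_assoc, inv_mul_cancel₀ h, mul_one]
  · subst hn
    push_cast at h
    have h' : q - 1 ≠ 0 := by simpa [sub_eq_add_neg] using h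
    simp [← sub_eq_add_neg, h']
  · rw [if_pos (by omega), if_pos (by omega)]
    obtain ⟨k, rfl⟩ : ∃ k : ℕ, n = k := ⟨n.toNat, by omega⟩
    rw [show ((k : ℤ) + 1).toNat = k + 1 by omega, Int.toNat_natCast, Finset.prod_range_succ]
    simp

lemma spoch_eq (q : ℝ) (n : ℤ) : spoch q n = (2 : ℝ) ^ n * poch (q / 2) n := by
  unfold spoch poch
  split_ifs with hn
  · obtain ⟨k, rfl⟩ : ∃ k : ℕ, n = k := ⟨n.toNat, by omega⟩
    rw [Int.toNat_natCast, zpow_natCast]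
    conv_rhs => rw [← Finset.card_range k, ← Finset.prod_const, Finset.card_range,
      ← Finset.prod_mul_distrib]
    exact Finset.prod_congr rfl fun i _ => by ring
  · obtain ⟨k, rfl⟩ : ∃ k : ℕ, n = -k := ⟨(-n).toNat, by omega⟩
    rw [neg_neg, Int.toNat_natCast, zpow_neg, zpow_natCast, one_div, one_div, ← mul_inv]
    conv_rhs => rw [← Finset.card_range k, ← Finset.prod_const, Finset.card_range,
      ← Finset.prod_mul_distrib]
    congr 1
    exact Finset.prod_congr rfl fun i _ => by ring

lemma poch_pos (q : ℝ) (n : ℤ) (hq : 0 < q) (h : 0 < q + n) : 0 < poch q n := by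
  unfold poch
  split_ifs with hn
  · exact Finset.prod_pos fun i _ => by positivity
  · apply one_div_pos.2
    refine Finset.prod_pos fun i hi => ?_
    have h1 : (i : ℤ) + 1 ≤ -n := by have := Finset.mem_range.1 hi; omega
    have h2 : (i : ℝ) + 1 ≤ -n := by exact_mod_cast h1
    linarith

lemma trapT_succ (q : ℝ) (n : ℤ) (m : ℕ) (h : ∀ i < m, q + n - i ≠ 0) :
    trapT q (n + 1) m = trapT q n m * ∏ i ∈ Finset.range m, (q + n - i) := by
  unfold trapT
  rw [Int.toNat_natCast, ← Finset.prod_mul_distrib]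
  refine Finset.prod_congr rfl fun i hi => ?_
  have := h i (Finset.mem_range.1 hi)
  have e : q + i + ((n - 2 * i : ℤ) : ℝ) = q + n - i := by push_cast; ring
  rw [show n + 1 - 2 * (i : ℤ) = n - 2 * i + 1 by ring, poch_succ _ _ (by rwa [e]), e]

lemma trapT_pos (q : ℝ) (n : ℤ) (m : ℕ) (hq : 0 < q) (h : ∀ i < m, 0 < q + n - i) :
    0 < trapT q n m := by
  unfold trapT
  rw [Int.toNat_natCast]
  refine Finset.prod_pos fun i hi => poch_pos _ _ (by positivity) ?_
  have := h i (Finset.mem_range.1 hi)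
  push_cast; linarith

lemma trapV_eq (q : ℝ) (n : ℤ) (m : ℕ) :
    trapV q n m = (∏ i ∈ Finset.range m, (2 : ℝ) ^ (n - 2 * i)) * trapT (q / 2) n m := by
  unfold trapV trapT
  rw [Int.toNat_natCast, ← Finset.prod_mul_distrib]
  refine Finset.prod_congr rfl fun i hi => ?_
  rw [spoch_eq]; congr 2; ring

lemma KR_two (c : ℤ) (y z : ℕ) :
    KR (fun y z => ∏ i ∈ Finset.range y, (2 : ℝ) ^ ((y : ℤ) + z + c - 2 * i)) y z = 1 / 2 := by
  have key : ∀ (n : ℤ) (m : ℕ), ∏ i ∈ Finset.range m, (2 : ℝ) ^ (n + 1 - 2 * i)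
      = (∏ i ∈ Finset.range m, (2 : ℝ) ^ (n - 2 * i)) * 2 ^ m := by
    intro n m
    conv_rhs => rw [← Finset.card_range m, ← Finset.prod_const, Finset.card_range,
      ← Finset.prod_mul_distrib]
    refine Finset.prod_congr rfl fun i _ => ?_
    rw [← zpow_add_one₀ two_ne_zero]; congr 1; ring
  simp only [KR]
  push_cast
  rw [show (y : ℤ) + (z + 1) + c = y + z + c + 1 by ring,
    show (y : ℤ) + 1 + (z + 1) + c = y + 1 + z + c + 1 by ring, key, key]
  have h1 : ∏ i ∈ Finset.range y, (2 : ℝ) ^ ((y : ℤ) + z + c - 2 * i) ≠ 0 :=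
    Finset.prod_ne_zero_iff.2 fun i _ => by positivity
  have h2 : ∏ i ∈ Finset.range (y + 1), (2 : ℝ) ^ ((y : ℤ) + 1 + z + c - 2 * i) ≠ 0 :=
    Finset.prod_ne_zero_iff.2 fun i _ => by positivity
  rw [pow_succ]
  field_simp

/-- trapezoids growing in both directions -/
lemma KR_trap1 (q : ℝ) (c : ℤ) (hq : 0 < q) (hc : 0 < q + c) (y z : ℕ) :
    KR (fun y z => trapT q ((y : ℤ) + z + c) y) y z = 1 / (q + y + z + c + 1) := by
  have hb : ∀ (k : ℕ) (j : ℤ), (k : ℤ) ≤ j + 1 → ∀ i < k, 0 < q + ((j + c : ℤ) : ℝ) - i := by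
    intro k j hk i hi
    have h1 : (i : ℤ) ≤ j := by omega
    have h2 : (i : ℝ) ≤ j := by exact_mod_cast h1
    push_cast; linarith
  simp only [KR]
  have p1 := trapT_pos q (y + z + c) y hq (hb y (y + z) (by omega))
  have p2 := trapT_pos q (y + z + c + 1) (y + 1) hq (by
    rw [show (y : ℤ) + z + c + 1 = (y + z + 1) + c by ring]; exact hb _ _ (by omega))
  have n1 := hb y (y + z) (by omega)
  have n2 := hb (y + 1) (y + z + 1) (by omega)
  rw [show ((y : ℤ) + z + 1 + c) = y + z + c + 1 by ring] at n2
  have e1 := trapT_succ q (y + z + c) y fun i hi => (n1 i hi).ne'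
  have e2 := trapT_succ q (y + z + c + 1) (y + 1) fun i hi => (n2 i hi).ne'
  push_cast at *
  rw [show (y : ℤ) + (z + 1) + c = y + z + c + 1 by ring,
    show (y : ℤ) + 1 + z + c = y + z + c + 1 by ring,
    show (y : ℤ) + 1 + (z + 1) + c = y + z + c + 1 + 1 by ring, e1, e2,
    Finset.prod_range_succ']
  have e3 : ∏ i ∈ Finset.range y, (q + (y + z + c + 1) - ((i + 1 : ℕ) : ℝ))
      = ∏ i ∈ Finset.range y, (q + (y + z + c : ℝ) - i) :=
    Finset.prod_congr rfl fun i _ => by push_cast; ring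
  rw [e3]
  have p3 : 0 < ∏ i ∈ Finset.range y, (q + (y + z + c : ℝ) - i) :=
    Finset.prod_pos fun i hi => n1 i (Finset.mem_range.1 hi)
  have p4 : 0 < q + y + z + c + 1 := by
    have : 0 < q + c + y + z + 1 := by positivity
    linarith
  have e4 : q + (y + z + c + 1) - ((0 : ℕ) : ℝ) = q + y + z + c + 1 := by push_cast; ring
  rw [e4]
  field_simp

lemma falling_step (k : ℝ) (b : ℕ) :
    (∏ i ∈ Finset.range b, (k + 1 - i)) * (k + 1 - b) = (k + 1) * ∏ i ∈ Finset.range b, (k - i) := by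
  rw [← Finset.prod_range_succ, Finset.prod_range_succ']
  have : ∏ i ∈ Finset.range b, (k + 1 - ((i + 1 : ℕ) : ℝ)) = ∏ i ∈ Finset.range b, (k - i) :=
    Finset.prod_congr rfl fun i _ => by push_cast; ring
  rw [this]; push_cast; ring

lemma KR_trap2 (x b y z : ℕ) :
    KR (fun y z => trapT ((x : ℝ) + z + 1) ((y : ℤ) + b - 1) b) y z
      = ((x : ℝ) + y + z + 1) / (x + y + z + b + 1) := by
  have hp : ∀ (y z : ℕ), ∀ i < b, 0 < (x : ℝ) + z + 1 + (((y : ℤ) + b - 1 : ℤ) : ℝ) - i := by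
    intro y z i hi
    have : (i : ℝ) + 1 ≤ b := by exact_mod_cast hi
    push_cast
    have : (0 : ℝ) ≤ x + y + z := by positivity
    linarith
  have hs : ∀ z : ℕ, trapT ((x : ℝ) + z + 1) (((y + 1 : ℕ) : ℤ) + b - 1) b
      = trapT ((x : ℝ) + z + 1) ((y : ℤ) + b - 1) b *
        ∏ i ∈ Finset.range b, ((x : ℝ) + y + z + b - i) := by
    intro z
    have := trapT_succ ((x : ℝ) + z + 1) ((y : ℤ) + b - 1) b fun i hi => (hp y z i hi).ne'
    rw [show (((y + 1 : ℕ) : ℤ) + b - 1) = (y : ℤ) + b - 1 + 1 by push_cast; ring, this]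
    congr 1
    exact Finset.prod_congr rfl fun i _ => by push_cast; ring
  have hT : ∀ z : ℕ, 0 < trapT ((x : ℝ) + z + 1) ((y : ℤ) + b - 1) b := fun z =>
    trapT_pos _ _ _ (by positivity) (hp y z)
  have hD : ∀ z : ℕ, 0 < ∏ i ∈ Finset.range b, ((x : ℝ) + y + z + b - i) := fun z =>
    Finset.prod_pos fun i hi => by
      have := hp y z i (Finset.mem_range.1 hi); push_cast at this; linarith
  simp only [KR]
  rw [hs, hs]
  have f := falling_step ((x : ℝ) + y + z + b) b
  have d1 := hD z
  have d2 := hD (z + 1)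
  have t1 := hT z
  have t2 := hT (z + 1)
  have e : ∏ i ∈ Finset.range b, ((x : ℝ) + y + (z + 1 : ℕ) + b - i)
      = ∏ i ∈ Finset.range b, ((x : ℝ) + y + z + b + 1 - i) :=
    Finset.prod_congr rfl fun i _ => by push_cast; ring
  rw [e] at d2 ⊢
  rw [div_eq_div_iff (by positivity) (by positivity)]
  linear_combination (-(trapT ((x : ℝ) + (z + 1 : ℕ) + 1) ((y : ℤ) + b - 1) b) *
    trapT ((x : ℝ) + z + 1) ((y : ℤ) + b - 1) b) * f

lemma hyperfac_pos (n : ℕ) : (0 : ℝ) < hyperfac n := by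
  unfold hyperfac; exact_mod_cast Finset.prod_pos fun i _ => Nat.factorial_pos i

lemma hyperfac2_pos (n : ℕ) : (0 : ℝ) < hyperfac2 n := by
  unfold hyperfac2
  have : 0 < ∏ i ∈ Finset.range (n / 2), (if n % 2 = 0 then (2 * i)! else (2 * i + 1)!) :=
    Finset.prod_pos fun i _ => by split_ifs <;> exact Nat.factorial_pos _
  exact_mod_cast this

lemma KR_hyperfac (c y z : ℕ) :
    KR (fun y z => (hyperfac (c + (y + z)) : ℝ)) y z = 1 / (c + y + z + 1) := by
  have := KR_step (fun n => (hyperfac (c + n) : ℝ)) (fun n => ((c + n)! : ℝ))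
    (fun n => (hyperfac_pos _).ne') (fun n => by positivity)
    (fun n => by
      rw [← add_assoc]; unfold hyperfac; rw [Finset.prod_range_succ]; push_cast; rfl) y z
  rw [this, ← add_assoc c (y + z) 1, Nat.factorial_succ]
  push_cast
  have : ((c + (y + z))! : ℝ) ≠ 0 := by positivity
  field_simp
  ring

lemma hyperfac2_odd (n : ℕ) :
    (hyperfac2 (2 * (n + 1) + 1) : ℝ) = hyperfac2 (2 * n + 1) * ((2 * n + 1)! : ℝ) := by
  unfold hyperfac2
  rw [show (2 * (n + 1) + 1) / 2 = n + 1 by omega, show (2 * n + 1) / 2 = n by omega]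
  simp [Finset.prod_range_succ, show (2 * (n + 1) + 1) % 2 = 1 by omega,
    show (2 * n + 1) % 2 = 1 by omega]

lemma KR_hyperfac2 (c y z : ℕ) :
    KR (fun y z => (hyperfac2 (2 * (c + (y + z)) + 1) : ℝ)) y z
      = 1 / ((2 * (c + y + z) + 2) * (2 * (c + y + z) + 3)) := by
  have := KR_step (fun n => (hyperfac2 (2 * (c + n) + 1) : ℝ)) (fun n => ((2 * (c + n) + 1)! : ℝ))
    (fun n => (hyperfac2_pos _).ne') (fun n => by positivity)
    (fun n => hyperfac2_odd (c + n)) y z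
  rw [this, show 2 * (c + (y + z + 1)) + 1 = 2 * (c + (y + z)) + 1 + 1 + 1 by ring,
    Nat.factorial_succ (2 * (c + (y + z)) + 1 + 1), Nat.factorial_succ (2 * (c + (y + z)) + 1)]
  push_cast
  have : ((2 * (c + (y + z)) + 1)! : ℝ) ≠ 0 := by positivity
  generalize ((2 * (c + (y + z)) + 1)! : ℝ) = F at *
  field_simp
  ring

lemma KR_fact (c y z : ℕ) :
    KR (fun y z => ((c + (y + z))! : ℝ)) y z = ((c : ℝ) + y + z + 1) / (c + y + z + 2) := by
  have := KR_step (fun n => ((c + n)! : ℝ)) (fun n => ((c + n + 1 : ℕ) : ℝ))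
    (fun n => by positivity) (fun n => by positivity)
    (fun n => by rw [← add_assoc, Nat.factorial_succ]; push_cast; ring) y z
  rw [this]
  push_cast
  congr 1 <;> ring

lemma Pf_diag (n c : ℕ) : Pf (n + 1) (n + 1) c = Pf n n c *
    (((c : ℝ) + n + 1) / (n + 1) * ∏ j ∈ Finset.range n, ((2 * (c : ℝ) + n + j + 2) / (n + j + 2))) := by
  unfold Pf
  simp only [Nat.sub_self, zero_add]
  rw [Finset.prod_Icc_succ_top (by omega)]
  congr 2
  · simp; ring
  · rw [← Finset.Ico_add_one_right_eq_Icc, Finset.prod_Ico_eq_prod_range]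
    refine Finset.prod_congr (by congr 1) fun j _ => ?_
    rw [show 2 * c + (n + 1) + (2 + j) - 1 = 2 * c + n + j + 2 by omega,
      show n + 1 + (2 + j) - 1 = n + j + 2 by omega]
    push_cast; rfl

lemma rising_step (k : ℝ) (n : ℕ) :
    (∏ j ∈ Finset.range (n + 1), (k + 1 + n + j + 2)) * (k + n + 2)
      = (∏ j ∈ Finset.range n, (k + n + j + 2)) * (k + 2 * n + 2) * (k + 2 * n + 3) := by
  have h : ∏ j ∈ Finset.range (n + 1), (k + 1 + n + j + 2)
      = ∏ j ∈ Finset.range (n + 1), (k + n + ((j + 1 : ℕ) : ℝ) + 2) :=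
    Finset.prod_congr rfl fun i _ => by push_cast; ring
  have h2 : (∏ j ∈ Finset.range (n + 1), (k + n + ((j + 1 : ℕ) : ℝ) + 2)) * (k + n + ((0 : ℕ) : ℝ) + 2)
    = ∏ j ∈ Finset.range (n + 1 + 1), (k + n + j + 2) :=
    (Finset.prod_range_succ' (fun j : ℕ => (k + n + j + 2 : ℝ)) (n + 1)).symm
  rw [h]
  rw [Finset.prod_range_succ (fun j : ℕ => (k + n + j + 2 : ℝ)) (n + 1),
    Finset.prod_range_succ (fun j : ℕ => (k + n + j + 2 : ℝ)) n] at h2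
  push_cast at h2 ⊢
  rw [add_zero] at h2
  rw [h2]; ring

lemma Pf_pos (n m c : ℕ) : 0 < Pf n m c := by
  unfold Pf
  refine Finset.prod_pos fun i hi => mul_pos (Finset.prod_pos fun j hj => ?_)
    (Finset.prod_pos fun j hj => ?_) <;>
  · rw [Finset.mem_Icc] at hi hj
    apply _root_.div_pos <;> exact_mod_cast (by omega)

lemma Pf'_pos (n m c : ℕ) : 0 < Pf' n m c := by
  unfold Pf'
  refine mul_pos (mul_pos (by positivity) (Finset.prod_pos fun i hi => ?_)) (Pf_pos _ _ _)
  rw [Finset.mem_Icc] at hi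
  apply _root_.div_pos <;> exact_mod_cast (by omega)

lemma KR_Pf (a b y z : ℕ) :
    KR (fun y z => Pf (y + z + b) (y + z + b) a) y z =
      (a + (y + z + b) + 1) / (a + (y + z + b) + 2) *
      (((y : ℝ) + z + b + 2) / (y + z + b + 1)) *
      ((2 * a + (y + z + b) + 2) / ((2 * a + 2 * (y + z + b) + 2) * (2 * a + 2 * (y + z + b) + 3))) *
      (((2 * (y + z + b) + 2) * (2 * (y + z + b) + 3)) / (y + z + b + 2)) := by
  have hp : ∀ n : ℕ, ∀ k : ℝ, 0 ≤ k → 0 < ∏ j ∈ Finset.range n, (k + n + j + 2) := fun n k hk =>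
    Finset.prod_pos fun i _ => by positivity
  have key := KR_step (fun n => Pf (n + b) (n + b) a)
    (fun n => (((a : ℝ) + (n + b : ℕ) + 1) / ((n + b : ℕ) + 1) *
      ∏ j ∈ Finset.range (n + b), ((2 * (a : ℝ) + (n + b : ℕ) + j + 2) / ((n + b : ℕ) + j + 2))))
    (fun n => (Pf_pos _ _ _).ne') (fun n => by
      apply ne_of_gt
      exact mul_pos (by positivity) (Finset.prod_pos fun i _ => by positivity))
    (fun n => by
      rw [show n + 1 + b = n + b + 1 by ring]; exact Pf_diag _ _) y z
  rw [key, show y + z + 1 + b = y + z + b + 1 by ring]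
  obtain ⟨n, hn⟩ : ∃ n, n = y + z + b := ⟨_, rfl⟩
  have hn' : (y : ℝ) + z + b = n := by rw [hn]; push_cast; ring
  rw [hn', ← hn, Finset.prod_div_distrib, Finset.prod_div_distrib]
  have r1 := rising_step (2 * a) n
  have r2 := rising_step 0 n
  have p1 := hp n (2 * a) (by positivity)
  have p2 := hp n 0 le_rfl
  have e1 : ∏ j ∈ Finset.range (n + 1), (2 * (a : ℝ) + (n + 1 : ℕ) + j + 2)
      = ∏ j ∈ Finset.range (n + 1), (2 * (a : ℝ) + 1 + n + j + 2) :=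
    Finset.prod_congr rfl fun i _ => by push_cast; ring
  have e2 : ∏ j ∈ Finset.range (n + 1), (((n + 1 : ℕ) : ℝ) + j + 2)
      = ∏ j ∈ Finset.range (n + 1), (0 + 1 + (n : ℝ) + j + 2) :=
    Finset.prod_congr rfl fun i _ => by push_cast; ring
  have e3 : ∏ j ∈ Finset.range n, ((n : ℝ) + j + 2)
      = ∏ j ∈ Finset.range n, (0 + (n : ℝ) + j + 2) :=
    Finset.prod_congr rfl fun i _ => by ring
  rw [e1, e2, e3, eq_div_of_mul_eq (by positivity) r1, eq_div_of_mul_eq (by positivity) r2]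
  generalize ∏ j ∈ Finset.range n, (2 * (a : ℝ) + n + j + 2) = A at *
  generalize ∏ j ∈ Finset.range n, (0 + (n : ℝ) + j + 2) = B at *
  push_cast
  simp only [zero_add]
  field_simp
  ring

lemma Q4_eq (a b x : ℕ) : ∃ C : ℝ, C ≠ 0 ∧ ∀ s : ℕ, Q4 a b x s = C *
    (((a + b + x + s)! : ℝ) / (hyperfac2 (2 * (b + s) + 1) : ℝ) *
      (hyperfac2 (2 * (a + b + x + s) + 1) : ℝ) *
      ((hyperfac (b + x + s) : ℝ) / (hyperfac (2 * a + b + x + 1 + s) : ℝ)) *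
      ((hyperfac (0 + s) : ℝ) / (hyperfac (2 * a + 2 * b + 2 * x + 1 + s) : ℝ)) *
      ((hyperfac (2 * a + 2 * b + x + 1 + s) : ℝ) / (hyperfac (x + s) : ℝ))) := by
  have hpos := fun n => (hyperfac_pos n).ne'
  have hpos2 := fun n => (hyperfac2_pos n).ne'
  refine ⟨((a + b)! / a ! : ℝ) / (a + b + x)! *
    (hyperfac2 (2 * (a + b) + 1) * hyperfac (2 * a + 2) / hyperfac2 (2 * a + 3) : ℝ) *
    (hyperfac (2 * (a + b + x) + 2) / hyperfac2 (2 * (a + b + x) + 3) : ℝ) *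
    (hyperfac b / hyperfac (a + b + a + 1) : ℝ) *
    (hyperfac x / hyperfac (a + b + x + (a + b) + 1) : ℝ) *
    (hyperfac (a + b + x + a + 1) / hyperfac (b + x) : ℝ), ?_, ?_⟩
  · simp [hpos, hpos2, Nat.factorial_ne_zero]
  · intro s
    have p1 : pSum (seqOf [a, b, x, s]) 1 = a := by simp [pSum, seqOf]
    have p2 : pSum (seqOf [a, b, x, s]) 2 = a + b := by
      simp [pSum, seqOf, Finset.sum_Icc_succ_top]
    have p3 : pSum (seqOf [a, b, x, s]) 3 = a + b + x := by
      simp [pSum, seqOf, Finset.sum_Icc_succ_top]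
    have p4 : pSum (seqOf [a, b, x, s]) 4 = a + b + x + s := by
      simp [pSum, seqOf, Finset.sum_Icc_succ_top]
    have pe : evenSum 2 (seqOf [a, b, x, s]) = b + s := by
      simp [evenSum, seqOf, Finset.sum_Icc_succ_top]
    have f1 : (Finset.Icc 1 (2 * 2) ×ˢ Finset.Icc 1 (2 * 2)).filter
        (fun p : ℕ × ℕ => p.1 < p.2 ∧ (p.2 - p.1) % 2 = 1) = {(1, 2), (1, 4), (2, 3), (3, 4)} := by
      decide
    have f2 : (Finset.Icc 1 (2 * 2) ×ˢ Finset.Icc 1 (2 * 2)).filter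
        (fun p : ℕ × ℕ => p.1 < p.2 ∧ (p.2 - p.1) % 2 = 0) = {(1, 3), (2, 4)} := by
      decide
    have g : Finset.Icc 1 2 = {1, 2} := by decide
    unfold Q4 Qfun
    rw [f1, f2, g, pe]
    rw [Finset.prod_insert (by decide), Finset.prod_insert (by decide),
      Finset.prod_insert (by decide), Finset.prod_insert (by decide),
      Finset.prod_insert (by decide), Finset.prod_insert (by decide)]
    simp only [Finset.prod_singleton, mul_one, show 2 * 2 = 4 from rfl, show 2 - 1 = 1 from rfl,
      show 4 - 1 = 3 from rfl, p1, p2, p3, p4]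
    rw [show a + b - a = b by omega, show a + b + x + s - a = b + x + s by omega,
      show a + b + x - (a + b) = x by omega, show a + b + x + s - (a + b + x) = 0 + s by omega,
      show a + b + x - a = b + x by omega, show a + b + x + s - (a + b) = x + s by omega,
      show a + b + x + s + a + 1 = 2 * a + b + x + 1 + s by omega,
      show a + b + x + s + (a + b + x) + 1 = 2 * a + 2 * b + 2 * x + 1 + s by omega,
      show a + b + x + s + (a + b) + 1 = 2 * a + 2 * b + x + 1 + s by omega]
    simp only [div_eq_mul_inv, mul_inv]
    ring

lemma KR_Q4 (a b x y z : ℕ) :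
    KR (fun y z => Q4 a b x (y + z)) y z =
      ((a + b + x : ℕ) + y + z + 1) / ((a + b + x : ℕ) + y + z + 2) /
      (1 / ((2 * (b + y + z) + 2) * (2 * (b + y + z) + 3))) *
      (1 / ((2 * ((a + b + x : ℕ) + y + z) + 2) * (2 * ((a + b + x : ℕ) + y + z) + 3))) *
      (1 / ((b + x : ℕ) + y + z + 1) / (1 / ((2 * a + b + x + 1 : ℕ) + y + z + 1))) *
      (1 / ((0 : ℕ) + y + z + 1) / (1 / ((2 * a + 2 * b + 2 * x + 1 : ℕ) + y + z + 1))) *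
      (1 / ((2 * a + 2 * b + x + 1 : ℕ) + y + z + 1) / (1 / ((x : ℝ) + y + z + 1))) := by
  obtain ⟨C, hC, h⟩ := Q4_eq a b x
  simp only [h, KR_mul, KR_div, KR_fact, KR_hyperfac, KR_hyperfac2]
  rw [KR_fst (fun _ => C) (fun _ => hC), one_mul]

lemma KR_trapV (q : ℝ) (hq : 2 < q) (y z : ℕ) :
    KR (fun y z => trapV q ((y : ℤ) + z - 1) y) y z = 1 / 2 * (1 / (q / 2 + y + z)) := by
  have h1 := KR_two (-1) y z
  have h2 := KR_trap1 (q / 2) (-1) (by linarith) (by push_cast; linarith) y z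
  simp only [trapV_eq, KR_mul]
  simp only [← sub_eq_add_neg] at h1 h2
  rw [h1, h2]
  push_cast
  congr 2
  ring

lemma trapb_ne (q : ℝ) (hq : 1 ≤ q) (y b : ℕ) : trapT q ((y : ℤ) + b - 1) b ≠ 0 := by
  refine (trapT_pos _ _ _ (by linarith) fun i hi => ?_).ne'
  have : (i : ℝ) + 1 ≤ b := by exact_mod_cast hi
  have : (0 : ℝ) ≤ y := by positivity
  push_cast
  linarith

lemma KR_Pf_simp (a b y z : ℕ) :
    KR (fun y z => Pf (y + z + b) (y + z + b) a) y z =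
      ((2 * a + b + y + z + 2) * (2 * (b + y + z) + 3) : ℝ) /
        ((a + b + y + z + 2) * (2 * (a + b + y + z) + 3)) := by
  rw [KR_Pf]
  obtain ⟨n, hn⟩ : ∃ n : ℝ, n = y + z + b := ⟨_, rfl⟩
  have hn0 : 0 ≤ n := by rw [hn]; positivity
  rw [show (2 * a + b + y + z + 2 : ℝ) = 2 * a + n + 2 by rw [hn]; ring,
    show (2 * (b + y + z) + 3 : ℝ) = 2 * n + 3 by rw [hn]; ring,
    show (a + b + y + z + 2 : ℝ) = a + n + 2 by rw [hn]; ring,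
    show (2 * (a + b + y + z) + 3 : ℝ) = 2 * a + 2 * n + 3 by rw [hn]; ring, ← hn,
    show (2 * a + 2 * n + 2 : ℝ) = 2 * (a + n + 1) by ring,
    show (2 * n + 2 : ℝ) = 2 * (n + 1) by ring]
  clear hn
  have h1 : 0 < (a : ℝ) + n + 1 := by positivity
  have h2 : 0 < (a : ℝ) + n + 2 := by positivity
  have h3 : 0 < n + 1 := by positivity
  have h4 : 0 < n + 2 := by positivity
  have h5 : 0 < 2 * (a : ℝ) + 2 * n + 3 := by positivity
  have h6 : 0 < 2 * n + 3 := by positivity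
  generalize (a : ℝ) + n + 1 = A1 at *
  generalize (a : ℝ) + n + 2 = A2 at *
  generalize n + 1 = A3 at *
  generalize 2 * (a : ℝ) + 2 * n + 3 = A5 at *
  generalize 2 * n + 3 = A6 at *
  field_simp

lemma psi_alg (n1 n2 N1 N2 N3 c1 c2 d1 d2 e1 e2 f1 f2 g1 g2 p q r : ℝ) (h1 : 0 < n1)
    (h2 : 0 < n2) (h3 : 0 < N1) (h4 : 0 < N2) (h5 : 0 < N3) (h6 : 0 < c1) (h8 : 0 < d1)
    (h10 : 0 < e1) (h11 : 0 < e2) (h12 : 0 < f1)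
    (h14 : 0 < g1) (h15 : 0 < g2) (h17 : 0 < q) (h18 : 0 < r)
    (hc : c2 = c1) (hd : d2 = d1) (hf : f2 = f1) :
    1 * 1 * (N1 / N2 / (1 / (2 * n1 * n2)) * (1 / (2 * N1 * N3)) * (1 / c1 / (1 / e1)) *
      (1 / d1 / (1 / p)) * (1 / q / (1 / f1))) / (g1 * n2 / (r * g2)) *
      (1 / 2 * (1 / (g2 / 2)) / (1 / 2 * (1 / (N3 / 2)))) *
      (1 / e1 * 1 * (d2 / n1)) / (1 / g1 * 1 * (f2 / c2)) = r * p / (N2 * q) := by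
  subst hc hd hf
  field_simp

/-- first ratio of `ψ`'s in the Kuo recurrence. -/
theorem claim_psi_ratio_one (x y z a b : ℕ) (hx : 1 ≤ x) (hy : 1 ≤ y) (hz : 1 ≤ z)
    (ha : 1 ≤ a) (hb : 1 ≤ b) :
    psi x (y - 1) z a b * psi x y (z - 1) a b /
        (psi x (y - 1) (z - 1) a b * psi x y z a b) =
      ((y : ℝ) + z + a + b) * (2 * (x : ℝ) + y + z + 2 * a + 2 * b) /
        (((x : ℝ) + y + z + a + b) * ((x : ℝ) + y + z + 2 * a + 2 * b)) := by
  obtain ⟨y, rfl⟩ : ∃ k, y = k + 1 := ⟨y - 1, by omega⟩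
  obtain ⟨z, rfl⟩ : ∃ k, z = k + 1 := ⟨z - 1, by omega⟩
  simp only [Nat.add_sub_cancel]
  change KR (fun y z => psi x y z a b) y z = _
  have t1 := KR_trap1 ((x : ℝ) + b + 1) (2 * a) (by positivity) (by push_cast; positivity) y z
  have t2 := KR_trap1 ((b : ℝ) + 1) (2 * a) (by positivity) (by push_cast; positivity) y z
  have t3 := KR_trap2 x b y z
  have t4 := KR_trap2 0 b y z
  simp only [Nat.cast_zero, zero_add] at t4
  have v1 := KR_trapV (2 * (a : ℝ) + 2 * b + 3)
    (by have : (0 : ℝ) ≤ a + b := by positivity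
        linarith) y z
  have v2 := KR_trapV (2 * (x : ℝ) + 2 * a + 2 * b + 3)
    (by have : (0 : ℝ) ≤ x + a + b := by positivity
        linarith) y z
  have k1 := KR_fst (fun y => Pf' y (y + 2 * a + 1) b) (fun n => (Pf'_pos _ _ _).ne') y z
  have k2 := KR_snd (fun z => Pf (z + b) (z + b) a) (fun n => (Pf_pos _ _ _).ne') y z
  have k3 := KR_fst (fun y => trapT (2 * (a : ℝ) + b + 2) ((y : ℤ) + b - 1) b)
    (fun n => trapb_ne _ (by have : (0 : ℝ) ≤ a + b := by positivity
                             have : (0 : ℝ) ≤ a := by positivity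
                             linarith) n b) y z
  have k4 := KR_fst (fun y => trapT ((x : ℝ) + 2 * (a : ℝ) + b + 2) ((y : ℤ) + b - 1) b)
    (fun n => trapb_ne _ (by have : (0 : ℝ) ≤ x + a + b := by positivity
                             have : (0 : ℝ) ≤ a := by positivity
                             linarith) n b) y z
  simp only [psi, KR_mul, KR_div]
  rw [t1, t2, t3, t4, v1, v2, k1, k2, k3, k4, KR_Q4, KR_Pf_simp]
  clear t1 t2 t3 t4 v1 v2 k1 k2 k3 k4
  have key := psi_alg (b + y + z + 1) (2 * (b + y + z) + 3) (a + b + x + y + z + 1)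
    (a + b + x + y + z + 2) (2 * (a + b + x + y + z) + 3) (b + x + y + z + 1) (b + x + y + z + 1)
    (y + z + 1) (y + z + 1) (2 * a + b + x + y + z + 2) (2 * a + b + y + z + 2)
    (x + y + z + 1) (x + y + z + 1) (2 * a + b + y + z + 2) (2 * (a + b + y + z) + 3)
    (2 * a + 2 * b + 2 * x + y + z + 2) (2 * a + 2 * b + x + y + z + 2) (a + b + y + z + 2)
    (by positivity) (by positivity) (by positivity) (by positivity) (by positivity)
    (by positivity) (by positivity) (by positivity) (by positivity) (by positivity)
    (by positivity) (by positivity) (by positivity) (by positivity) rfl rfl rfl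
  push_cast
  convert key using 1
  · congr 1
    · congr 1
      · congr 1
        · congr 1
          congr 1
          congr 1
          · congr 1
            · congr 1
              · congr 1
                · congr 1
                  congr 1
                  ring
                · congr 1
                  ring
              · congr 2
                ring
            · congr 2
              · ring
              · ring
          · congr 2
            ring
        · congr 3
          · ring
          · congr 1
            ring
      · congr 2
        · congr 1
          ring
        · ring
    · congr 2
      · congr 1
        ring
      · ring
  · congr 1 <;> ring
end

section
/- For all integers x, z ≥ 0 and a, b ≥ 1, the explicit product φ_{x,y,z}(a,b) evaluated at y = 0 satisfies φ_{x,0,z}(a,b) = Q(a,b,x,z). -/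
open Finset Nat

lemma poch_cancel_nat (p : ℝ) (hp : 0 < p) (m : ℕ) :
    poch p m * poch (p + m) (-(m : ℤ)) = 1 := by
  rcases Nat.eq_zero_or_pos m with rfl | hm
  · simp [poch]
  · have h1 : (0 : ℤ) ≤ (m : ℤ) := by omega
    have h2 : ¬ (0 : ℤ) ≤ -(m : ℤ) := by omega
    unfold poch
    rw [if_pos h1, if_neg h2]
    simp only [neg_neg, Int.toNat_natCast]
    have h3 : ∏ i ∈ Finset.range m, (p + m - ((i : ℝ) + 1)) =
        ∏ i ∈ Finset.range m, (p + (i : ℝ)) := by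
      rw [← Finset.prod_range_reflect]
      refine Finset.prod_congr rfl fun i hi => ?_
      have hi' : i + 1 ≤ m := Finset.mem_range.mp hi
      have h4 : ((m - 1 - i : ℕ) : ℝ) = m - 1 - i := by
        rw [Nat.sub_sub, Nat.cast_sub (by omega)]
        push_cast
        ring
      rw [h4]
      ring
    rw [h3]
    have h5 : (∏ i ∈ Finset.range m, (p + (i : ℝ))) ≠ 0 :=
      Finset.prod_ne_zero_iff.mpr fun i _ => by positivity
    field_simp

lemma poch_cancel (p : ℝ) (k : ℤ) (hp : 0 < p) (hk : 0 < p + k) :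
    poch p k * poch (p + k) (-k) = 1 := by
  rcases Int.eq_nat_or_neg k with ⟨m, rfl | rfl⟩
  · exact_mod_cast poch_cancel_nat p hp m
  · have h := poch_cancel_nat (p + ((-(m : ℤ) : ℤ) : ℝ)) hk m
    rw [mul_comm, neg_neg]
    convert h using 3
    push_cast
    ring

lemma trapT_one (q : ℝ) (hq : 0 < q) (n : ℕ) :
    trapT q (((0 : ℕ) : ℤ) + n - 1) n = 1 := by
  unfold trapT
  rw [Int.toNat_natCast]
  refine Finset.prod_involution (fun i _ => n - 1 - i) ?_ ?_ ?_ ?_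
  · intro i hi
    have hi' : i < n := Finset.mem_range.mp hi
    have h4 : ((n - 1 - i : ℕ) : ℤ) = n - 1 - i := by omega
    have h4' : ((n - 1 - i : ℕ) : ℝ) = n - 1 - i := by exact_mod_cast congrArg (Int.cast : ℤ → ℝ) h4
    have h := poch_cancel (q + i) (((0 : ℕ) : ℤ) + n - 1 - 2 * i) (by positivity) (by
      have : (0 : ℝ) ≤ ((n - 1 - i : ℕ) : ℝ) := Nat.cast_nonneg _
      rw [h4'] at this
      push_cast
      linarith)
    convert h using 3
    · rw [h4']
      push_cast
      ring
    · rw [h4]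
      push_cast
      ring
  · intro i hi hne heq
    apply hne
    have hi' : i < n := Finset.mem_range.mp hi
    have : ((0 : ℕ) : ℤ) + n - 1 - 2 * i = 0 := by omega
    rw [this]
    simp [poch]
  · intro i hi
    have hi' : i < n := Finset.mem_range.mp hi
    exact Finset.mem_range.mpr (by omega)
  · intro i hi
    have hi' : i < n := Finset.mem_range.mp hi
    show n - 1 - (n - 1 - i) = i
    omega

lemma Pf_ne_zero (a b c : ℕ) : Pf a b c ≠ 0 := by
  unfold Pf
  refine Finset.prod_ne_zero_iff.mpr fun i hi => mul_ne_zero ?_ ?_ <;>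
  · refine Finset.prod_ne_zero_iff.mpr fun j hj => ?_
    rw [Finset.mem_Icc] at hi hj
    exact div_ne_zero (Nat.cast_ne_zero.mpr (by omega)) (Nat.cast_ne_zero.mpr (by omega))

/-- `φ` at `y = 0` is `Q(a,b,x,z)`. -/
theorem claim_phi_y_zero (x z a b : ℕ) (ha : 1 ≤ a) (hb : 1 ≤ b) :
    phi x 0 z a b = Q4 a b x z := by
  unfold phi
  rw [trapT_one _ (by positivity), trapT_one _ (by positivity), trapT_one _ (by positivity),
    trapT_one _ (by positivity), trapT_one _ (by positivity), trapT_one _ (by positivity),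
    trapT_one _ (by positivity), trapT_one _ (by positivity)]
  have h0 : Pf 0 (0 + 2 * a) b = 1 := by simp [Pf]
  have h1 := Pf_ne_zero (z + b) (z + b) a
  rw [h0, Nat.zero_add]
  field_simp
end

section
/- For all integers x, y ≥ 0 and a, b ≥ 1, the explicit product φ_{x,y,z}(a,b) evaluated at z = 0 factors as φ_{x,y,0}(a,b) = Q(0,a,b+x,y) · Q(a,b). -/
open Finset Nat

/-- real-valued hyperfactorial -/
noncomputable def hr (n : ℕ) : ℝ := (hyperfac n : ℝ)

/-- real-valued odd skipping hyperfactorial `H₂(2n+1)` -/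
noncomputable def gr (n : ℕ) : ℝ := (hyperfac2 (2 * n + 1) : ℝ)

lemma hr_def (n : ℕ) : hr n = (hyperfac n : ℝ) := rfl

lemma gr_def (n : ℕ) : gr n = (hyperfac2 (2 * n + 1) : ℝ) := rfl

lemma hr_succ (n : ℕ) : hr (n + 1) = hr n * (n ! : ℝ) := by
  simp [hr, hyperfac, Finset.prod_range_succ]

lemma hr_zero : hr 0 = 1 := by simp [hr, hyperfac]

lemma gr_succ (n : ℕ) : gr (n + 1) = gr n * ((2 * n + 1)! : ℝ) := by
  have h1 : (2 * (n + 1) + 1) / 2 = n + 1 := by omega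
  have h2 : (2 * n + 1) / 2 = n := by omega
  have h3 : (2 * (n + 1) + 1) % 2 = 1 := by omega
  have h4 : (2 * n + 1) % 2 = 1 := by omega
  simp only [gr, hyperfac2, h1, h2, h3, h4, Finset.prod_range_succ]
  simp

lemma gr_zero : gr 0 = 1 := by simp [gr, hyperfac2]

lemma hr_one : hr 1 = 1 := by simp [hr, hyperfac]

lemma hr_two : hr 2 = 1 := by simp [hr, hyperfac, Finset.prod_range_succ]

lemma hr_ne (n : ℕ) : hr n ≠ 0 := by
  induction n with
  | zero => simp [hr_zero]
  | succ n ih =>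
    rw [hr_succ]; exact mul_ne_zero ih (by exact_mod_cast Nat.factorial_ne_zero n)

lemma gr_ne (n : ℕ) : gr n ≠ 0 := by
  induction n with
  | zero => simp [gr_zero]
  | succ n ih =>
    rw [gr_succ]; exact mul_ne_zero ih (by exact_mod_cast Nat.factorial_ne_zero _)

lemma fac_eq (n : ℕ) : (n ! : ℝ) = hr (n + 1) / hr n := by
  rw [hr_succ]; field_simp [hr_ne n]

lemma hr_pos (n : ℕ) : 0 < hr n := lt_of_le_of_ne (by unfold hr; positivity) (hr_ne n).symm

lemma gr_pos (n : ℕ) : 0 < gr n := lt_of_le_of_ne (by unfold gr; positivity) (gr_ne n).symm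

/-- logarithm of `hr` -/
noncomputable def lh (n : ℕ) : ℝ := Real.log (hr n)

/-- logarithm of `gr` -/
noncomputable def lg (n : ℕ) : ℝ := Real.log (gr n)

lemma hr_exp (n : ℕ) : hr n = Real.exp (lh n) := (Real.exp_log (hr_pos n)).symm

lemma gr_exp (n : ℕ) : gr n = Real.exp (lg n) := (Real.exp_log (gr_pos n)).symm

lemma lh_zero : lh 0 = 0 := by simp [lh, hr_zero]

lemma lh_one : lh 1 = 0 := by simp [lh, hr_one]

lemma lh_two : lh 2 = 0 := by simp [lh, hr_two]

lemma lg_zero : lg 0 = 0 := by simp [lg, gr_zero]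

lemma fac_ne (n : ℕ) : (n ! : ℝ) ≠ 0 := by exact_mod_cast Nat.factorial_ne_zero n

lemma asc_prod (p n : ℕ) : ∏ i ∈ Finset.range n, ((p : ℝ) + 1 + i) = ((p + n)! : ℝ) / (p ! : ℝ) := by
  induction n with
  | zero => simp [div_self (fac_ne _)]
  | succ n ih =>
    rw [Finset.prod_range_succ, ih, ← Nat.add_assoc, Nat.factorial_succ]
    push_cast
    ring

lemma poch_eq (p k : ℕ) (n : ℤ) (h : (k : ℤ) = p + n) :
    poch ((p : ℝ) + 1) n = (k ! : ℝ) / (p ! : ℝ) := by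
  unfold poch
  split_ifs with hn
  · obtain ⟨m, rfl⟩ := Int.eq_ofNat_of_zero_le hn
    have : k = p + m := by omega
    subst this
    simpa using asc_prod p m
  · obtain ⟨m, hm⟩ := Int.eq_ofNat_of_zero_le (show 0 ≤ -n by omega)
    have : p = k + m := by omega
    subst this
    rw [hm, ← Finset.prod_range_reflect]
    have := asc_prod k m
    have e : ∀ j ∈ Finset.range m, (((k + m : ℕ) : ℝ) + 1 - (((m - 1 - j : ℕ) : ℝ) + 1)) = (k : ℝ) + 1 + j := by
      intro j hj
      rw [Finset.mem_range] at hj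
      have : m - 1 - j + (j + 1) = m := by omega
      have h2 : ((m - 1 - j : ℕ) : ℝ) + (j + 1) = m := by exact_mod_cast this
      push_cast
      linarith
    rw [Int.toNat_natCast]
    rw [Finset.prod_congr rfl e, this]
    simp

lemma prod_fac (p m : ℕ) : ∏ i ∈ Finset.range m, ((p + i)! : ℝ) = hr (p + m) / hr p := by
  induction m with
  | zero => simp [hr_ne]
  | succ m ih =>
    rw [Finset.prod_range_succ, ih, ← Nat.add_assoc, hr_succ]; ring

lemma prod_gfac (p m : ℕ) :
    ∏ i ∈ Finset.range m, ((2 * (p + i) + 1)! : ℝ) = gr (p + m) / gr p := by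
  induction m with
  | zero => simp [gr_ne]
  | succ m ih =>
    rw [Finset.prod_range_succ, ih, ← Nat.add_assoc, gr_succ]; ring

lemma trapT_eq (q : ℝ) (p y m : ℕ) (hq : q = p + 1) :
    trapT q ((y : ℤ) + m - 1) m = hr (p + y + m) * hr p / (hr (p + y) * hr (p + m)) := by
  subst hq
  unfold trapT
  have e : ∀ i ∈ Finset.range (m : ℤ).toNat, poch ((p : ℝ) + 1 + i) ((y : ℤ) + m - 1 - 2 * i)
      = ((p + y + (m - 1 - i))! : ℝ) / ((p + i)! : ℝ) := by
    intro i hi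
    have hi : i < m := by simpa using hi
    rw [← poch_eq (p + i) (p + y + (m - 1 - i)) ((y : ℤ) + m - 1 - 2 * i) (by omega)]
    congr 1
    push_cast; ring
  rw [Finset.prod_congr rfl e, Finset.prod_div_distrib, Int.toNat_natCast,
    Finset.prod_range_reflect (fun i => ((p + y + i)! : ℝ)), prod_fac, prod_fac]
  field_simp [hr_ne]

lemma prod_Icc_fac (u s m : ℕ) :
    ∏ j ∈ Finset.Icc (s + 1) (s + m), ((u + j : ℕ) : ℝ) =
      ((u + s + m)! : ℝ) / ((u + s)! : ℝ) := by
  induction m with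
  | zero => simp [div_self (fac_ne _)]
  | succ m ih =>
    rw [← Nat.add_assoc s m 1, Finset.prod_Icc_succ_top (by omega), ih,
      ← Nat.add_assoc (u + s) m 1, Nat.factorial_succ]
    push_cast
    ring

lemma prod_Icc_ratio (u v s m : ℕ) :
    ∏ j ∈ Finset.Icc (s + 1) (s + m), ((u + (v + 1) + j - 1 : ℕ) : ℝ) / ((v + 1 + j - 1 : ℕ) : ℝ) =
      ((u + v + s + m)! : ℝ) / ((u + v + s)! : ℝ) / (((v + s + m)! : ℝ) / ((v + s)! : ℝ)) := by
  rw [Finset.prod_div_distrib, ← prod_Icc_fac, ← prod_Icc_fac]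
  congr 1
  · refine Finset.prod_congr rfl fun j _ => ?_
    congr 1
    omega
  · refine Finset.prod_congr rfl fun j _ => ?_
    congr 1
    omega

lemma Pf_eq (y d c : ℕ) : Pf y (y + 2 * d) c =
    hr (c + 2 * d + y + 1) / hr (c + 2 * d + 1) * (hr c / hr (c + y)) * hr y
    * (gr (c + d + y) / gr (c + d)) * (gr d / gr (d + y))
    * (hr (2 * c + 2 * d + 1) / hr (2 * c + 2 * d + y + 1)) := by
  unfold Pf
  have e : y + 2 * d - y = 2 * d := by omega
  rw [e]
  clear e
  induction y with
  | zero => simp [hr_ne, gr_ne, hr_zero]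
  | succ y ih =>
    have A := prod_Icc_ratio c y 0 (2 * d + 1)
    have B := prod_Icc_ratio (2 * c) y (2 * d + 1) y
    rw [Nat.zero_add, Nat.zero_add] at A
    rw [Finset.prod_Icc_succ_top (by omega), ih, A, show 2 * d + (y + 1) = 2 * d + 1 + y by ring, B]
    rw [show c + 2 * d + (y + 1) + 1 = (c + y + 0 + (2 * d + 1)) + 1 by ring,
      show c + 2 * d + y + 1 = c + y + 0 + (2 * d + 1) by ring,
      ← Nat.add_assoc c y 1, ← Nat.add_assoc (c + d) y 1, ← Nat.add_assoc d y 1,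
      show 2 * c + 2 * d + (y + 1) + 1 = (2 * c + y + (2 * d + 1)) + 1 by ring,
      show 2 * c + 2 * d + y + 1 = 2 * c + y + (2 * d + 1) by ring]
    simp only [hr_succ, gr_succ]
    rw [show 2 * (c + d + y) + 1 = 2 * c + y + (2 * d + 1) + y by ring,
      show 2 * (d + y) + 1 = y + (2 * d + 1) + y by ring]
    simp only [Nat.add_zero, fac_eq, hr_exp, gr_exp, ← Real.exp_add, ← Real.exp_sub]
    congr 1
    ring

lemma pairs_odd (f : ℕ × ℕ → ℝ) : ∏ p ∈ (Finset.Icc 1 (2 * 2) ×ˢ Finset.Icc 1 (2 * 2)).filter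
        (fun p => p.1 < p.2 ∧ (p.2 - p.1) % 2 = 1), f p = f (1,2) * f (2,3) * f (3,4) * f (1,4) := by
  rw [show (Finset.Icc 1 (2 * 2) ×ˢ Finset.Icc 1 (2 * 2)).filter
        (fun p : ℕ × ℕ => p.1 < p.2 ∧ (p.2 - p.1) % 2 = 1) = {(1,2),(2,3),(3,4),(1,4)} by decide]
  simp [mul_assoc]

lemma pairs_even (f : ℕ × ℕ → ℝ) : ∏ p ∈ (Finset.Icc 1 (2 * 2) ×ˢ Finset.Icc 1 (2 * 2)).filter
        (fun p => p.1 < p.2 ∧ (p.2 - p.1) % 2 = 0), f p = f (1,3) * f (2,4) := by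
  rw [show (Finset.Icc 1 (2 * 2) ×ˢ Finset.Icc 1 (2 * 2)).filter
        (fun p : ℕ × ℕ => p.1 < p.2 ∧ (p.2 - p.1) % 2 = 0) = {(1,3),(2,4)} by decide]
  simp

lemma pairs_odd1 (f : ℕ × ℕ → ℝ) : ∏ p ∈ (Finset.Icc 1 (2 * 1) ×ˢ Finset.Icc 1 (2 * 1)).filter
        (fun p => p.1 < p.2 ∧ (p.2 - p.1) % 2 = 1), f p = f (1,2) := by
  rw [show (Finset.Icc 1 (2 * 1) ×ˢ Finset.Icc 1 (2 * 1)).filter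
        (fun p : ℕ × ℕ => p.1 < p.2 ∧ (p.2 - p.1) % 2 = 1) = {(1,2)} by decide]
  simp

lemma pairs_even1 (f : ℕ × ℕ → ℝ) : ∏ p ∈ (Finset.Icc 1 (2 * 1) ×ˢ Finset.Icc 1 (2 * 1)).filter
        (fun p => p.1 < p.2 ∧ (p.2 - p.1) % 2 = 0), f p = 1 := by
  rw [show (Finset.Icc 1 (2 * 1) ×ˢ Finset.Icc 1 (2 * 1)).filter
        (fun p : ℕ × ℕ => p.1 < p.2 ∧ (p.2 - p.1) % 2 = 0) = ∅ by decide]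
  simp

lemma Q2_eq (a b c d s2 s3 s4 : ℕ) (h2 : s2 = a + b) (h3 : s3 = s2 + c) (h4 : s4 = s3 + d) :
    Qfun 2 (seqOf [a, b, c, d]) =
    (s2 ! : ℝ) * (s4 ! : ℝ) / ((a ! : ℝ) * (s3 ! : ℝ)) / gr (b + d)
    * (gr s2 * hr (2 * a + 2) * gr s4 * hr (2 * s3 + 2) / (gr (a + 1) * gr (s3 + 1)))
    * (hr b * hr c * hr d * hr (b + c + d) /
        (hr (s2 + a + 1) * hr (s3 + s2 + 1) * hr (s4 + s3 + 1) * hr (s4 + a + 1)))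
    * (hr (s3 + a + 1) * hr (s4 + s2 + 1) / (hr (b + c) * hr (c + d))) := by
  have p1 : pSum (seqOf [a, b, c, d]) 1 = a := by simp [pSum, seqOf]
  have p2 : pSum (seqOf [a, b, c, d]) 2 = s2 := by
    simp [pSum, seqOf, Finset.sum_Icc_succ_top, h2]
  have p3 : pSum (seqOf [a, b, c, d]) 3 = s3 := by
    simp [pSum, seqOf, Finset.sum_Icc_succ_top, h2, h3]
  have p4 : pSum (seqOf [a, b, c, d]) 4 = s4 := by
    simp [pSum, seqOf, Finset.sum_Icc_succ_top, h2, h3, h4]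
  have pe : evenSum 2 (seqOf [a, b, c, d]) = b + d := by
    simp [evenSum, seqOf, Finset.sum_Icc_succ_top]
  unfold Qfun
  rw [pairs_odd, pairs_even, pe, show Finset.Icc 1 2 = {1, 2} by decide]
  simp only [Finset.prod_pair (show (1 : ℕ) ≠ 2 by decide)]
  norm_num only
  rw [p1, p2, p3, p4]
  rw [show s2 - a = b by omega, show s3 - s2 = c by omega, show s4 - s3 = d by omega,
    show s4 - a = b + c + d by omega, show s3 - a = b + c by omega, show s4 - s2 = c + d by omega]
  rw [show 2 * a + 3 = 2 * (a + 1) + 1 by ring, show 2 * s3 + 3 = 2 * (s3 + 1) + 1 by ring]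
  simp only [← hr_def, ← gr_def]
  ring

lemma Q1_eq (a b s2 : ℕ) (h2 : s2 = a + b) :
    Qfun 1 (seqOf [a, b]) =
    (s2 ! : ℝ) / (a ! : ℝ) / gr b
    * (gr s2 * hr (2 * a + 2) / gr (a + 1)) * (hr b / hr (s2 + a + 1)) := by
  have p1 : pSum (seqOf [a, b]) 1 = a := by simp [pSum, seqOf]
  have p2 : pSum (seqOf [a, b]) 2 = s2 := by
    simp [pSum, seqOf, Finset.sum_Icc_succ_top, h2]
  have pe : evenSum 1 (seqOf [a, b]) = b := by
    simp [evenSum, seqOf]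
  unfold Qfun
  rw [pairs_odd1, pairs_even1, pe, show Finset.Icc 1 1 = {1} by decide]
  simp only [Finset.prod_singleton]
  norm_num only
  rw [p1, p2]
  rw [show s2 - a = b by omega]
  rw [show 2 * a + 3 = 2 * (a + 1) + 1 by ring]
  simp only [← hr_def, ← gr_def]
  ring

/-- factorization of `φ` at `z = 0`. -/
theorem claim_phi_z_zero (x y a b : ℕ) (ha : 1 ≤ a) (hb : 1 ≤ b) :
    phi x y 0 a b = Qfun 2 (seqOf [0, a, b + x, y]) * Qfun 1 (seqOf [a, b]) := by
  unfold phi Q4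
  rw [trapT_eq ((x : ℝ) + b + 1) (x + b) y a (by push_cast; ring),
    trapT_eq _ (x + a + b + 1) y a (by push_cast; ring),
    trapT_eq _ (2 * a + b + 1) y b (by push_cast; ring),
    trapT_eq _ 0 y b (by push_cast; ring),
    trapT_eq ((b : ℝ) + 1) b y a (by push_cast; ring),
    trapT_eq _ (a + b + 1) y a (by push_cast; ring),
    trapT_eq _ (x + 2 * a + b + 1) y b (by push_cast; ring),
    trapT_eq _ x y b (by push_cast; ring), Pf_eq,
    show Pf (0 + b) (0 + b) a = Pf b (b + 2 * 0) a by simp,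
    show Pf (y + 0 + b) (y + 0 + b) a = Pf (y + b) (y + b + 2 * 0) a by simp,
    Pf_eq, Pf_eq, Q2_eq _ _ _ _ _ _ _ rfl rfl rfl, Q2_eq _ _ _ _ _ _ _ rfl rfl rfl,
    Q1_eq _ _ _ rfl]
  simp only [gr_succ, fac_eq, hr_exp, gr_exp, ← Real.exp_add, ← Real.exp_sub]
  congr 1
  ring_nf
  simp only [lh_zero, lh_one, lh_two, lg_zero]
  ring
end

section
/- Let a = (a_1,…,a_{2k}) be a sequence of positive integers with k ≥ 2. For all integers x, y, z ≥ 1, the correction factor f_{x,y,z}(a) satisfies f_{x+1,y-1,z-1}(a) · f_{x-1,y,z}(a) = f_{x,y-1,z-1}(a) · f_{x,y,z}(a). -/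
open Finset Nat

/-- `o_i(a) = a (2i-1) + a (2i+1) + ⋯ + a (2k-1)`. -/
def oddTail (k : ℕ) (a : ℕ → ℕ) (i : ℕ) : ℕ := ∑ j ∈ Finset.Icc i k, a (2 * j - 1)

/-- `e_i(a) = a (2i) + a (2i+2) + ⋯ + a (2k)`. -/
def evenTail (k : ℕ) (a : ℕ → ℕ) (i : ℕ) : ℕ := ∑ j ∈ Finset.Icc i k, a (2 * j)

/-- The correction factor `f_{x,y,z}(a)` for a sequence `a = (a 1, …, a (2k))`. -/
noncomputable def ffun (k : ℕ) (a : ℕ → ℕ) (x y z : ℕ) : ℝ :=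
  (Qfun (k + 1) (fun i => if i = 1 then 0 else if i = 2 * k + 2 then y else a (i - 1)) *
      Qfun k (fun i => if i = 2 * k then a (2 * k) + z else a i)) /
    (Pf y (y + 2 * oddTail k a 1) (evenTail k a 1) *
      Pf (z + evenTail k a 1) (z + evenTail k a 1) (oddTail k a 1)) *
    (∏ i ∈ Finset.Icc 2 k,
      (trapT ((x : ℝ) + z + evenTail k a i + 1)
          ((a (2 * i - 2) : ℤ) + oddTail k a i - 1) (oddTail k a i) *
        trapT ((y : ℝ) + evenTail k a i + 1)
          ((a (2 * i - 2) : ℤ) + oddTail k a i - 1) (oddTail k a i)) /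
      (trapT ((x : ℝ) + y + evenTail k a i + 1)
          ((a (2 * i - 2) : ℤ) + oddTail k a i - 1) (oddTail k a i) *
        trapT ((z : ℝ) + evenTail k a i + 1)
          ((a (2 * i - 2) : ℤ) + oddTail k a i - 1) (oddTail k a i))) *
    (∏ i ∈ Finset.Icc 2 k,
      (trapT ((x : ℝ) + y + pSum a (2 * i - 1) + pSum a (2 * k) + 2)
          ((a (2 * i - 2) : ℤ) + oddTail k a i - 1) (oddTail k a i) *
        trapT ((z : ℝ) + pSum a (2 * i - 1) + pSum a (2 * k) + 2)
          ((a (2 * i - 2) : ℤ) + oddTail k a i - 1) (oddTail k a i)) /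
      (trapT ((x : ℝ) + z + pSum a (2 * i - 1) + pSum a (2 * k) + 2)
          ((a (2 * i - 2) : ℤ) + oddTail k a i - 1) (oddTail k a i) *
        trapT ((y : ℝ) + pSum a (2 * i - 1) + pSum a (2 * k) + 2)
          ((a (2 * i - 2) : ℤ) + oddTail k a i - 1) (oddTail k a i)))

/-- `Φ_{x,y,z}(a) = φ_{x,y,z}(O(a),E(a)) · f_{x,y,z}(a)`. -/
noncomputable def PhiFun (k : ℕ) (a : ℕ → ℕ) (x y z : ℕ) : ℝ :=
  phi x y z (oddTail k a 1) (evenTail k a 1) * ffun k a x y z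

/-- The part of the correction factor depending on a single argument `w`. -/
noncomputable def gaux (k : ℕ) (a : ℕ → ℕ) (w : ℝ) : ℝ :=
  (∏ i ∈ Finset.Icc 2 k, trapT (w + evenTail k a i + 1)
      ((a (2 * i - 2) : ℤ) + oddTail k a i - 1) (oddTail k a i)) /
    ∏ i ∈ Finset.Icc 2 k, trapT (w + pSum a (2 * i - 1) + pSum a (2 * k) + 2)
      ((a (2 * i - 2) : ℤ) + oddTail k a i - 1) (oddTail k a i)

/-- `f` splits as a factor independent of `x` times `g(x+z) / g(x+y)`. -/
lemma ffun_split (k : ℕ) (a : ℕ → ℕ) (y z : ℕ) :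
    ∃ C : ℝ, ∀ x : ℕ, ffun k a x y z =
      C * gaux k a ((x : ℝ) + z) * (gaux k a ((x : ℝ) + y))⁻¹ := by
  refine ⟨(Qfun (k + 1) (fun i => if i = 1 then 0 else if i = 2 * k + 2 then y else a (i - 1)) *
      Qfun k (fun i => if i = 2 * k then a (2 * k) + z else a i)) /
    (Pf y (y + 2 * oddTail k a 1) (evenTail k a 1) *
      Pf (z + evenTail k a 1) (z + evenTail k a 1) (oddTail k a 1)) *
      gaux k a y * (gaux k a z)⁻¹, fun x => ?_⟩
  unfold ffun gaux
  simp only [Finset.prod_div_distrib, Finset.prod_mul_distrib]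
  simp only [div_eq_mul_inv, mul_inv, inv_inv]
  ring

/-- the correction factor `f` satisfies
`f_{x+1,y-1,z-1} · f_{x-1,y,z} = f_{x,y-1,z-1} · f_{x,y,z}`. -/
theorem claim_f_inv_two (k : ℕ) (hk : 2 ≤ k) (a : ℕ → ℕ)
    (ha : ∀ i ∈ Finset.Icc 1 (2 * k), 1 ≤ a i)
    (x y z : ℕ) (hx : 1 ≤ x) (hy : 1 ≤ y) (hz : 1 ≤ z) :
    ffun k a (x + 1) (y - 1) (z - 1) * ffun k a (x - 1) y z =
      ffun k a x (y - 1) (z - 1) * ffun k a x y z := by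
  obtain ⟨x, rfl⟩ := Nat.exists_eq_add_of_le' hx
  obtain ⟨y, rfl⟩ := Nat.exists_eq_add_of_le' hy
  obtain ⟨z, rfl⟩ := Nat.exists_eq_add_of_le' hz
  simp only [Nat.add_sub_cancel]
  obtain ⟨C, hC⟩ := ffun_split k a y z
  obtain ⟨D, hD⟩ := ffun_split k a (y + 1) (z + 1)
  rw [hC, hC, hD, hD]
  have e1 : ∀ w : ℕ, ((x + 1 + 1 : ℕ) : ℝ) + w = ((x + 1 : ℕ) : ℝ) + ((w + 1 : ℕ) : ℝ) := by
    intro w; push_cast; ring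
  have e2 : ∀ w : ℕ, (x : ℝ) + ((w + 1 : ℕ) : ℝ) = ((x + 1 : ℕ) : ℝ) + w := by
    intro w; push_cast; ring
  rw [e1, e1, e2, e2]
  ring
end

section
/- Let a = (a_1,…,a_{2k}) be a sequence of positive integers with k ≥ 2, and define Φ_{x,y,z}(a) = φ_{x,y,z}(O(a),E(a)) · f_{x,y,z}(a). For all integers x, y, z ≥ 1, Φ satisfies the Kuo condensation recurrence Φ_{x,y,z}(a) · Φ_{x,y-1,z-1}(a) = Φ_{x,y-1,z}(a) · Φ_{x,y,z-1}(a) + Φ_{x+1,y-1,z-1}(a) · Φ_{x-1,y,z}(a). -/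
open Finset Nat

namespace KuoPhi

/-- Real-valued factorial. -/
noncomputable def F (n : ℕ) : ℝ := (n ! : ℝ)

/-- Real-valued hyperfactorial. -/
noncomputable def G (n : ℕ) : ℝ := (hyperfac n : ℝ)

/-- Real-valued odd skipping hyperfactorial `H₂(2n+1)`. -/
noncomputable def K (n : ℕ) : ℝ := (hyperfac2 (2 * n + 1) : ℝ)

lemma F_ne (n : ℕ) : F n ≠ 0 := by
  unfold F; exact_mod_cast n.factorial_ne_zero

lemma F_succ (n : ℕ) : F (n + 1) = ((n : ℝ) + 1) * F n := by
  unfold F; rw [Nat.factorial_succ]; push_cast; ring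

lemma G_succ (n : ℕ) : G (n + 1) = F n * G n := by
  unfold F G hyperfac; rw [Finset.prod_range_succ]; push_cast; ring

lemma G_ne (n : ℕ) : G n ≠ 0 := by
  induction n with
  | zero => simp [G, hyperfac]
  | succ n ih => rw [G_succ]; exact mul_ne_zero (F_ne n) ih

lemma K_succ (n : ℕ) : K (n + 1) = F (2 * n + 1) * K n := by
  have h : ∀ m, K m = ∏ i ∈ Finset.range m, F (2 * i + 1) := by
    intro m
    unfold K F hyperfac2
    have h1 : (2 * m + 1) / 2 = m := by omega
    have h2 : (2 * m + 1) % 2 = 1 := by omega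
    rw [h1, h2]; simp
  rw [h, h, Finset.prod_range_succ]; ring

lemma K_ne (n : ℕ) : K n ≠ 0 := by
  induction n with
  | zero => simp [K, hyperfac2]
  | succ n ih => rw [K_succ]; exact mul_ne_zero (F_ne _) ih

lemma prod_F_add (q m : ℕ) : ∏ i ∈ Finset.range m, F (q + i) = G (q + m) / G q := by
  induction m with
  | zero => simp [G_ne]
  | succ m ih =>
    rw [Finset.prod_range_succ, ih, ← add_assoc, G_succ]; ring

lemma prod_shift (u n : ℕ) : ∏ i ∈ Finset.range n, ((u : ℝ) + 1 + i) = F (u + n) / F u := by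
  induction n with
  | zero => simp [F_ne]
  | succ m ih =>
    rw [Finset.prod_range_succ, ih, ← add_assoc, F_succ]; push_cast; ring

lemma prod_shift_down (v n : ℕ) :
    ∏ i ∈ Finset.range n, (((v + n : ℕ) : ℝ) + 1 - (i + 1)) = F (v + n) / F v := by
  rw [← prod_shift, ← Finset.prod_range_reflect]
  apply Finset.prod_congr rfl
  intro i hi
  have hi := Finset.mem_range.1 hi
  have : ((n - 1 - i : ℕ) : ℝ) = n - 1 - i := by
    rw [Nat.cast_sub (by omega), Nat.cast_sub (by omega)]; simp
  rw [this]; push_cast; ring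

lemma poch_eq (u v : ℕ) (q : ℝ) (n : ℤ) (hq : q = (u : ℝ) + 1) (hn : n = (v : ℤ) - u) :
    poch q n = F v / F u := by
  subst hq hn
  unfold poch
  split_ifs with h
  · obtain ⟨d, rfl⟩ : ∃ d, v = u + d := ⟨v - u, by omega⟩
    have : (((u + d : ℕ) : ℤ) - u).toNat = d := by omega
    rw [this, prod_shift]
  · obtain ⟨d, rfl⟩ : ∃ d, u = v + d := ⟨u - v, by omega⟩
    have : (-((v : ℤ) - (v + d : ℕ))).toNat = d := by omega
    rw [this, prod_shift_down]; simp

lemma trapT_eq (q y m : ℕ) (r : ℝ) (hr : r = (q : ℝ) + 1) :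
    trapT r ((y : ℤ) + m - 1) m = G (q + y + m) * G q / (G (q + y) * G (q + m)) := by
  subst hr
  unfold trapT
  have h1 : ∀ i ∈ Finset.range ((m : ℤ).toNat),
      poch ((q : ℝ) + 1 + i) ((y : ℤ) + m - 1 - 2 * i) = F (q + y + (m - 1 - i)) / F (q + i) := by
    intro i hi
    have hi := Finset.mem_range.1 hi
    apply poch_eq
    · push_cast; ring
    · omega
  rw [Finset.prod_congr rfl h1, Finset.prod_div_distrib]
  simp only [Int.toNat_natCast]
  rw [Finset.prod_range_reflect (fun i => F (q + y + i)) m, prod_F_add, prod_F_add]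
  have := G_ne (q + y)
  have := G_ne q
  have := G_ne (q + m)
  field_simp

/-- Row factor in Proctor's formula. -/
noncomputable def row (a i : ℕ) : ℝ :=
  ((a : ℝ) + i + 1) / (i + 1) * (F (2 * a + 2 * i + 1) / F (2 * a + i + 1)) /
    (F (2 * i + 1) / F (i + 1))

lemma prod_row (c i : ℕ) :
    ∏ j ∈ Finset.Icc (0 + 2) (0 + (i + 1)), ((c + (i + 1) + j - 1 : ℕ) : ℝ) =
      F (c + 2 * i + 1) / F (c + i + 1) := by
  rw [← Finset.Ico_add_one_right_eq_Icc, Finset.prod_Ico_eq_prod_range]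
  have h : 0 + (i + 1) + 1 - (0 + 2) = i := by omega
  rw [h]
  have := prod_shift (c + i + 1) i
  rw [show c + 2 * i + 1 = c + i + 1 + i by ring, ← this]
  apply Finset.prod_congr rfl
  intro j _
  rw [show c + (i + 1) + (0 + 2 + j) - 1 = c + i + 1 + 1 + j by omega]
  push_cast; ring

lemma Pf_diag (n a : ℕ) : Pf n n a = ∏ i ∈ Finset.range n, row a i := by
  unfold Pf
  rw [← Finset.Ico_add_one_right_eq_Icc, Finset.prod_Ico_eq_prod_range]
  simp only [Nat.sub_self, Nat.add_sub_cancel]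
  apply Finset.prod_congr rfl
  intro i _
  rw [Nat.add_comm 1 i]
  rw [Finset.prod_div_distrib (s := Finset.Icc (0 + 2) _), prod_row (2 * a) i]
  have h := prod_row 0 i
  simp only [Nat.zero_add] at h
  simp only [Nat.zero_add, h]
  simp [row]
  ring

lemma Pf_diag_succ (n a : ℕ) : Pf (n + 1) (n + 1) a = row a n * Pf n n a := by
  rw [Pf_diag, Pf_diag, Finset.prod_range_succ]; ring

lemma row_ne (a i : ℕ) : row a i ≠ 0 := by
  unfold row
  have h1 : (a : ℝ) + i + 1 ≠ 0 := by positivity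
  have h2 : (i : ℝ) + 1 ≠ 0 := by positivity
  exact div_ne_zero (mul_ne_zero (div_ne_zero h1 h2) (div_ne_zero (F_ne _) (F_ne _)))
    (div_ne_zero (F_ne _) (F_ne _))

lemma Pf_diag_ne (n a : ℕ) : Pf n n a ≠ 0 := by
  rw [Pf_diag]; exact Finset.prod_ne_zero_iff.2 fun i _ => row_ne a i

lemma row_succ (a n : ℕ) : row a (n + 1) * ((2 * a + n + 2) * (2 * n + 3)) =
    row a n * ((a + n + 2) * (2 * a + 2 * n + 3)) := by
  unfold row
  rw [show 2 * a + 2 * (n + 1) + 1 = 2 * a + 2 * n + 1 + 1 + 1 by ring,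
    show 2 * a + (n + 1) + 1 = 2 * a + n + 1 + 1 by ring,
    show 2 * (n + 1) + 1 = 2 * n + 1 + 1 + 1 by ring]
  simp only [F_succ]
  have := F_ne (2 * a + 2 * n)
  have := F_ne (2 * a + n)
  have := F_ne (2 * n)
  have := F_ne n
  push_cast
  field_simp
  ring

lemma Q4_eq (a b x w : ℕ) : Q4 a b x w =
    F (a + b) * F (a + b + x + w) / (F a * F (a + b + x)) / K (b + w) *
    (K (a + b) * K (a + b + x + w) * G (2 * a + 2) * G (2 * (a + b + x) + 2) /
      (K (a + 1) * K (a + b + x + 1))) *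
    (G b * G x * G w * G (b + x + w) /
      (G (2 * a + b + 1) * G (2 * a + 2 * b + x + 1) * G (2 * a + 2 * b + 2 * x + w + 1) *
        G (2 * a + b + x + w + 1))) *
    (G (2 * a + b + x + 1) * G (2 * a + 2 * b + x + w + 1) / (G (b + x) * G (x + w))) := by
  unfold Q4 Qfun
  have p1 : pSum (seqOf [a, b, x, w]) 1 = a := by simp [pSum, seqOf]
  have p2 : pSum (seqOf [a, b, x, w]) 2 = a + b := by
    simp [pSum, seqOf, Finset.sum_Icc_succ_top]
  have p3 : pSum (seqOf [a, b, x, w]) 3 = a + b + x := by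
    simp [pSum, seqOf, Finset.sum_Icc_succ_top]
  have p4 : pSum (seqOf [a, b, x, w]) 4 = a + b + x + w := by
    simp [pSum, seqOf, Finset.sum_Icc_succ_top]
  have e : evenSum 2 (seqOf [a, b, x, w]) = b + w := by
    simp [evenSum, seqOf, Finset.sum_Icc_succ_top]
  have s1 : (Finset.Icc 1 (2 * 2) ×ˢ Finset.Icc 1 (2 * 2)).filter
      (fun p : ℕ × ℕ => p.1 < p.2 ∧ (p.2 - p.1) % 2 = 1) = {(1, 2), (2, 3), (3, 4), (1, 4)} := by
    decide
  have s2 : (Finset.Icc 1 (2 * 2) ×ˢ Finset.Icc 1 (2 * 2)).filter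
      (fun p : ℕ × ℕ => p.1 < p.2 ∧ (p.2 - p.1) % 2 = 0) = {(1, 3), (2, 4)} := by
    decide
  have s3 : Finset.Icc 1 2 = {1, 2} := by decide
  rw [e, s1, s2, s3]
  rw [Finset.prod_pair (by decide), Finset.prod_pair (by decide), Finset.prod_pair (by decide),
    Finset.prod_insert (by decide), Finset.prod_insert (by decide), Finset.prod_pair (by decide)]
  simp only [Nat.mul_one, Nat.reduceMul, Nat.reduceSub, p1, p2, p3, p4]
  rw [show a + b - a = b by omega, show a + b + x - (a + b) = x by omega,
    show a + b + x + w - (a + b + x) = w by omega, show a + b + x + w - a = b + x + w by omega,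
    show a + b + x - a = b + x by omega, show a + b + x + w - (a + b) = x + w by omega,
    show a + b + a + 1 = 2 * a + b + 1 by ring,
    show a + b + x + (a + b) + 1 = 2 * a + 2 * b + x + 1 by ring,
    show a + b + x + w + (a + b + x) + 1 = 2 * a + 2 * b + 2 * x + w + 1 by ring,
    show a + b + x + w + a + 1 = 2 * a + b + x + w + 1 by ring,
    show a + b + x + a + 1 = 2 * a + b + x + 1 by ring,
    show a + b + x + w + (a + b) + 1 = 2 * a + 2 * b + x + w + 1 by ring,
    show 2 * a + 3 = 2 * (a + 1) + 1 by ring,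
    show 2 * (a + b + x) + 3 = 2 * (a + b + x + 1) + 1 by ring]
  simp only [F, G, K]
  ring

/-- The factor depending on `x` only. -/
noncomputable def X (a b x : ℕ) : ℝ :=
  G (2 * (a + b + x) + 2) * G x * G (2 * a + b + x + 1) /
    (F (a + b + x) * K (a + b + x + 1) * G (2 * a + 2 * b + x + 1) * G (b + x)) *
  (G (b + x) / G (a + b + x)) * (G (2 * a + 2 * b + x + 1) / G (2 * a + b + x + 1))

/-- The factor depending on `w = y + z` only. -/
noncomputable def Y (a b w : ℕ) : ℝ :=
  G w / (K (b + w) * Pf (b + w) (b + w) a) * (G (b + w) / G w) *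
    (G (a + b + w + 1) / G (2 * a + b + w + 1))

/-- The factor depending on `s = x + y + z` only. -/
noncomputable def S (a b s : ℕ) : ℝ :=
  F (a + b + s) * K (a + b + s) * G (b + s) * G (2 * a + 2 * b + s + 1) /
    (G (2 * a + b + s + 1) * G s) * (G (2 * a + b + s + 1) / G (a + b + s + 1)) *
    (G s / G (b + s))

/-- The factor depending on `2x + y + z` only. -/
noncomputable def U (a b u : ℕ) : ℝ := 1 / G (2 * a + 2 * b + u + 1)

lemma X_rec (a b x : ℕ) : X a b (x + 2) * X a b x =
    X a b (x + 1) ^ 2 * (2 * (2 * (a + b + x + 1) + 1) * (x + 1)) := by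
  unfold X
  have e1 : 2 * (a + b + (x + 2)) + 2 = 2 * (a + b + x) + 2 + 1 + 1 + 1 + 1 := by ring
  have e2 : 2 * (a + b + (x + 1)) + 2 = 2 * (a + b + x) + 2 + 1 + 1 := by ring
  have e3 : 2 * (a + b + x + 1) + 1 = 2 * (a + b + x) + 1 + 1 + 1 := by ring
  have e4 : 2 * (a + b + x + 1 + 1) + 1 = 2 * (a + b + x) + 1 + 1 + 1 + 1 + 1 := by ring
  rw [e1, e2, show x + 2 = x + 1 + 1 from rfl]
  simp only [← Nat.add_assoc]
  rw [show ∀ p, p + x + 1 + 1 + 1 = (p + x) + 1 + 1 + 1 from fun _ => rfl]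
  simp only [G_succ, K_succ, e3, e4, F_succ]
  have := F_ne (2 * (a + b + x))
  have := F_ne (a + b + x)
  have := F_ne (b + x)
  have := F_ne x
  have := F_ne (2 * a + b + x)
  have := F_ne (2 * a + 2 * b + x)
  have := G_ne (2 * (a + b + x))
  have := G_ne (a + b + x)
  have := G_ne (b + x)
  have := G_ne x
  have := G_ne (2 * a + b + x)
  have := G_ne (2 * a + 2 * b + x)
  have := K_ne (a + b + x)
  push_cast
  field_simp
  ring

lemma Y_rec (a b w : ℕ) : Y a b (w + 2) * Y a b w * (2 * (2 * (a + b + w + 1) + 1)) =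
    Y a b (w + 1) ^ 2 := by
  unfold Y
  have e3 : 2 * (b + w + 1) + 1 = 2 * (b + w) + 1 + 1 + 1 := by ring
  rw [show w + 2 = w + 1 + 1 from rfl]
  simp only [← Nat.add_assoc]
  have hr := row_succ a (b + w)
  simp only [Pf_diag_succ, G_succ, K_succ, e3, F_succ]
  have := F_ne (2 * (b + w))
  have := F_ne (a + b + w)
  have := F_ne (b + w)
  have := F_ne w
  have := F_ne (2 * a + b + w)
  have := G_ne (a + b + w)
  have := G_ne (b + w)
  have := G_ne w
  have := G_ne (2 * a + b + w)
  have := K_ne (b + w)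
  have := Pf_diag_ne (b + w) a
  have := row_ne a (b + w)
  have := row_ne a (b + w + 1)
  push_cast at hr ⊢
  have hrow : row a (b + w + 1) = row a (b + w) *
      ((a + (b + w) + 2) * (2 * a + 2 * (b + w) + 3)) /
      ((2 * a + (b + w) + 2) * (2 * (b + w) + 3)) := by
    rw [eq_div_iff (by positivity)]; exact hr
  rw [hrow]
  field_simp
  ring

lemma S_rec (a b s : ℕ) : S a b (s + 2) * S a b s =
    S a b (s + 1) ^ 2 * (2 * (2 * (a + b + s + 1) + 1) * (2 * a + 2 * b + s + 2)) := by
  unfold S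
  have e3 : 2 * (a + b + s + 1) + 1 = 2 * (a + b + s) + 1 + 1 + 1 := by ring
  rw [show s + 2 = s + 1 + 1 from rfl]
  simp only [← Nat.add_assoc]
  simp only [G_succ, K_succ, e3, F_succ]
  have := F_ne (2 * (a + b + s))
  have := F_ne (a + b + s)
  have := F_ne (b + s)
  have := F_ne s
  have := F_ne (2 * a + b + s)
  have := F_ne (2 * a + 2 * b + s)
  have := G_ne (a + b + s)
  have := G_ne (b + s)
  have := G_ne s
  have := G_ne (2 * a + b + s)
  have := G_ne (2 * a + 2 * b + s)
  have := K_ne (a + b + s)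
  push_cast
  field_simp
  ring

lemma U_rec (a b u : ℕ) : U a b (u + 2) * U a b u * (2 * a + 2 * b + u + 2) =
    U a b (u + 1) ^ 2 := by
  unfold U
  rw [show u + 2 = u + 1 + 1 from rfl]
  simp only [← Nat.add_assoc]
  simp only [G_succ, F_succ]
  have := F_ne (2 * a + 2 * b + u)
  have := G_ne (2 * a + 2 * b + u)
  push_cast
  field_simp
  ring

/-- `y`-only factor of `phi`. -/
noncomputable def pA (a b y : ℕ) : ℝ :=
  Pf y (y + 2 * a) b * trapT (2 * (a : ℝ) + b + 2) ((y : ℤ) + b - 1) b /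
    trapT ((b : ℝ) + 1) ((y : ℤ) + a - 1) a *
  (F (a + b) / F a * (K (a + b) * G (2 * a + 2) / K (a + 1)) * (G b / G (2 * a + b + 1)))

/-- `z`-only factor of `phi`. -/
noncomputable def pB (a b z : ℕ) : ℝ :=
  Pf (z + b) (z + b) a * (G z / G (z + b)) * (G (z + 2 * a + b + 1) / G (z + a + b + 1))

/-- `x+z` factor of `phi`. -/
noncomputable def pC (a b s : ℕ) : ℝ :=
  G (s + a + b + 1) / G (s + 2 * a + b + 1) * (G (s + b) / G s)

/-- `x+y` factor of `phi`. -/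
noncomputable def pD (a b s : ℕ) : ℝ :=
  G (s + a + b) / G (s + b) * (G (s + 2 * a + b + 1) / G (s + 2 * a + 2 * b + 1))

lemma phi_eq (x y z a b : ℕ) : phi x y z a b =
    pA a b y * pB a b z * pC a b (x + z) * pD a b (x + y) *
      (X a b x * Y a b (y + z) * S a b (x + y + z) * U a b (2 * x + y + z)) := by
  unfold phi
  rw [Q4_eq, trapT_eq (x + b) y a ((x : ℝ) + b + 1) (by push_cast; ring),
    trapT_eq (x + z + a + b + 1) y a ((x : ℝ) + z + a + b + 2) (by push_cast; ring),
    trapT_eq z y b ((z : ℝ) + 1) rfl,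
    trapT_eq (z + a + b + 1) y a ((z : ℝ) + a + b + 2) (by push_cast; ring),
    trapT_eq (x + 2 * a + b + 1) y b ((x : ℝ) + 2 * a + b + 2) (by push_cast; ring),
    trapT_eq (x + z) y b ((x : ℝ) + z + 1) (by push_cast; ring)]
  unfold pA pB pC pD X Y S U
  generalize trapT (2 * (a : ℝ) + b + 2) ((y : ℤ) + b - 1) b = t1
  generalize trapT ((b : ℝ) + 1) ((y : ℤ) + a - 1) a = t2
  generalize Pf y (y + 2 * a) b = t3
  rw [show y + z + b = b + (y + z) by ring]
  generalize Pf (z + b) (z + b) a = t4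
  generalize Pf (b + (y + z)) (b + (y + z)) a = t5
  ring_nf
  field_simp [G_ne, F_ne, K_ne]

/-- `x+z` and `x+y` factors of `ffun`. -/
noncomputable def fR (k : ℕ) (a : ℕ → ℕ) (s : ℕ) : ℝ :=
  (∏ i ∈ Finset.Icc 2 k, trapT ((s : ℝ) + evenTail k a i + 1)
          ((a (2 * i - 2) : ℤ) + oddTail k a i - 1) (oddTail k a i)) /
  (∏ i ∈ Finset.Icc 2 k, trapT ((s : ℝ) + pSum a (2 * i - 1) + pSum a (2 * k) + 2)
          ((a (2 * i - 2) : ℤ) + oddTail k a i - 1) (oddTail k a i))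

/-- `y` factor of `ffun`. -/
noncomputable def fA (k : ℕ) (a : ℕ → ℕ) (y : ℕ) : ℝ :=
  Qfun (k + 1) (fun i => if i = 1 then 0 else if i = 2 * k + 2 then y else a (i - 1)) /
    Pf y (y + 2 * oddTail k a 1) (evenTail k a 1) * fR k a y

/-- `z` factor of `ffun`. -/
noncomputable def fB (k : ℕ) (a : ℕ → ℕ) (z : ℕ) : ℝ :=
  Qfun k (fun i => if i = 2 * k then a (2 * k) + z else a i) /
      Pf (z + evenTail k a 1) (z + evenTail k a 1) (oddTail k a 1) * (fR k a z)⁻¹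

lemma ffun_eq (k : ℕ) (a : ℕ → ℕ) (x y z : ℕ) : ffun k a x y z =
    fA k a y * fB k a z * fR k a (x + z) * (fR k a (x + y))⁻¹ := by
  unfold ffun fA fB fR
  simp only [Finset.prod_mul_distrib, Finset.prod_inv_distrib, Nat.cast_add, mul_inv_rev,
    div_eq_mul_inv, inv_inv]
  ring

lemma Phi_eq (k : ℕ) (a : ℕ → ℕ) : ∃ (b c : ℕ) (A B C D : ℕ → ℝ), ∀ x y z, PhiFun k a x y z =
    A y * B z * C (x + z) * D (x + y) *
      (X b c x * Y b c (y + z) * S b c (x + y + z) * U b c (2 * x + y + z)) := by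
  refine ⟨oddTail k a 1, evenTail k a 1,
    fun y => pA (oddTail k a 1) (evenTail k a 1) y * fA k a y,
    fun z => pB (oddTail k a 1) (evenTail k a 1) z * fB k a z,
    fun s => pC (oddTail k a 1) (evenTail k a 1) s * fR k a s,
    fun s => pD (oddTail k a 1) (evenTail k a 1) s * (fR k a s)⁻¹, fun x y z => ?_⟩
  unfold PhiFun
  rw [phi_eq, ffun_eq]
  ring

lemma core (a b x w : ℕ) :
    (X a b (x + 1) * Y a b (w + 2) * S a b (x + w + 3) * U a b (2 * x + w + 4)) *
      (X a b (x + 1) * Y a b w * S a b (x + w + 1) * U a b (2 * x + w + 2)) =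
    (X a b (x + 1) * Y a b (w + 1) * S a b (x + w + 2) * U a b (2 * x + w + 3)) ^ 2 +
    (X a b (x + 2) * Y a b w * S a b (x + w + 2) * U a b (2 * x + w + 4)) *
      (X a b x * Y a b (w + 2) * S a b (x + w + 2) * U a b (2 * x + w + 2)) := by
  have hX := X_rec a b x
  have hY := Y_rec a b w
  have hS := S_rec a b (x + w + 1)
  have hU := U_rec a b (2 * x + w + 2)
  push_cast at hX hY hS hU
  simp only [Nat.add_assoc, Nat.reduceAdd] at *
  have e1 : (X a b (x + 1) * Y a b (w + 2) * S a b (x + (w + 3)) * U a b (2 * x + (w + 4))) *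
      (X a b (x + 1) * Y a b w * S a b (x + (w + 1)) * U a b (2 * x + (w + 2))) =
      X a b (x + 1) ^ 2 * (Y a b (w + 2) * Y a b w) * (S a b (x + (w + 3)) * S a b (x + (w + 1))) *
      (U a b (2 * x + (w + 4)) * U a b (2 * x + (w + 2))) := by ring
  have e2 : (X a b (x + 2) * Y a b w * S a b (x + (w + 2)) * U a b (2 * x + (w + 4))) *
      (X a b x * Y a b (w + 2) * S a b (x + (w + 2)) * U a b (2 * x + (w + 2))) =
      (X a b (x + 2) * X a b x) * (Y a b (w + 2) * Y a b w) * S a b (x + (w + 2)) ^ 2 *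
      (U a b (2 * x + (w + 4)) * U a b (2 * x + (w + 2))) := by ring
  rw [e1, e2, mul_pow, mul_pow, mul_pow, ← hY, ← hU, hS, hX]
  ring

end KuoPhi

/-- Kuo condensation recurrence for `Φ`. -/
theorem claim_Phi_kuo (k : ℕ) (hk : 2 ≤ k) (a : ℕ → ℕ)
    (ha : ∀ i ∈ Finset.Icc 1 (2 * k), 1 ≤ a i)
    (x y z : ℕ) (hx : 1 ≤ x) (hy : 1 ≤ y) (hz : 1 ≤ z) :
    PhiFun k a x y z * PhiFun k a x (y - 1) (z - 1) =
      PhiFun k a x (y - 1) z * PhiFun k a x y (z - 1) +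
        PhiFun k a (x + 1) (y - 1) (z - 1) * PhiFun k a (x - 1) y z := by
  obtain ⟨b, c, A, B, C, D, h⟩ := KuoPhi.Phi_eq k a
  obtain ⟨x, rfl⟩ : ∃ x0, x = x0 + 1 := ⟨x - 1, by omega⟩
  obtain ⟨y, rfl⟩ : ∃ y0, y = y0 + 1 := ⟨y - 1, by omega⟩
  obtain ⟨z, rfl⟩ : ∃ z0, z = z0 + 1 := ⟨z - 1, by omega⟩
  simp only [Nat.add_sub_cancel, h]
  have hc := KuoPhi.core b c x (y + z)
  rw [show y + 1 + (z + 1) = y + z + 2 by ring, show y + 1 + z = y + z + 1 by ring,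
    show y + (z + 1) = y + z + 1 by ring,
    show x + 1 + (y + 1) + (z + 1) = x + (y + z) + 3 by ring,
    show x + 1 + y + z = x + (y + z) + 1 by ring,
    show x + 1 + y + (z + 1) = x + (y + z) + 2 by ring,
    show x + 1 + (y + 1) + z = x + (y + z) + 2 by ring,
    show x + 1 + 1 + y + z = x + (y + z) + 2 by ring,
    show x + (y + 1) + (z + 1) = x + (y + z) + 2 by ring,
    show 2 * (x + 1) + (y + 1) + (z + 1) = 2 * x + (y + z) + 4 by ring,
    show 2 * (x + 1) + y + z = 2 * x + (y + z) + 2 by ring,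
    show 2 * (x + 1) + y + (z + 1) = 2 * x + (y + z) + 3 by ring,
    show 2 * (x + 1) + (y + 1) + z = 2 * x + (y + z) + 3 by ring,
    show 2 * (x + 1 + 1) + y + z = 2 * x + (y + z) + 4 by ring,
    show 2 * x + (y + 1) + (z + 1) = 2 * x + (y + z) + 2 by ring,
    show x + 1 + (z + 1) = x + z + 2 by ring, show x + 1 + z = x + z + 1 by ring,
    show x + 1 + (y + 1) = x + y + 2 by ring, show x + 1 + y = x + y + 1 by ring,
    show x + 1 + 1 + z = x + z + 2 by ring, show x + 1 + 1 + y = x + y + 2 by ring,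
    show x + (z + 1) = x + z + 1 by ring, show x + (y + 1) = x + y + 1 by ring,
    show x + 1 + 1 = x + 2 from rfl]
  linear_combination (A (y + 1) * A y * B (z + 1) * B z * C (x + z + 2) * C (x + z + 1) *
    D (x + y + 2) * D (x + y + 1)) * hc
end
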